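/- arXiv:1912.00309 — 2 statements merged into one kernel-verified Lean document; each statement's English description precedes it below -/
import Mathlib

section
/- Let m ≥ 2 and n ≥ 2m+1. Then σ(C_{2m+1}, n) = max{2n + 4m² − 6m, m(2n − m − 1)} + 2; that is, every graphic sequence π of length n with σ(π) ≥ max{2n + 4m² − 6m, m(2n − m − 1)} + 2 is potentially C_{2m+1}-graphic, and there exists a graphic sequence π of length n with σ(π) = max{2n + 4m² − 6m, m(2n − m − 1)} that is not potentially C_{2m+1}-graphic. -/
/-- `G` contains a cycle of length `r`. -/
def hasCycleOfLength {V : Type*} (G : SimpleGraph V) (r : ℕ) : Prop :=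
  ∃ (v : V) (c : G.Walk v v), c.IsCycle ∧ c.length = r

/-- `G` is a realization of the sequence `d`, i.e. `d` is its degree sequence. -/
def IsDegreeSeq {n : ℕ} (G : SimpleGraph (Fin n)) (d : Fin n → ℕ) : Prop :=
  ∀ i, (G.neighborSet i).ncard = d i

/-- The sequence `d` is graphic: it is the degree sequence of a simple graph. -/
def Graphic {n : ℕ} (d : Fin n → ℕ) : Prop :=
  ∃ G : SimpleGraph (Fin n), IsDegreeSeq G d

/-- `d` is potentially ₃Cℓ-graphic: some realization contains cycles of every
length `r` with `3 ≤ r ≤ ℓ`. -/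
def Pot3C {n : ℕ} (ℓ : ℕ) (d : Fin n → ℕ) : Prop :=
  ∃ G : SimpleGraph (Fin n), IsDegreeSeq G d ∧ ∀ r, 3 ≤ r → r ≤ ℓ → hasCycleOfLength G r

/-- `d` is potentially Cℓ-graphic: some realization contains a cycle of length `ℓ`. -/
def PotC {n : ℕ} (ℓ : ℕ) (d : Fin n → ℕ) : Prop :=
  ∃ G : SimpleGraph (Fin n), IsDegreeSeq G d ∧ hasCycleOfLength G ℓ

/-- `d` has a realization `G` containing cycles `C₃, …, C_ℓ` on those vertices with
degrees `d 0, …, d (ℓ-1)`: the induced subgraph on some vertex set `S`, whose multiset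
of degrees is that of the first `ℓ` terms of `d`, contains cycles of all lengths
from `3` to `ℓ`. -/
def RealizationWithCyclesOn {n : ℕ} (ℓ : ℕ) (d : Fin n → ℕ) : Prop :=
  ∃ (G : SimpleGraph (Fin n)) (S : Finset (Fin n)),
    IsDegreeSeq G d ∧ S.card = ℓ ∧
    S.val.map d = (Finset.univ.filter (fun i : Fin n => (i : ℕ) < ℓ)).val.map d ∧
    ∀ r, 3 ≤ r → r ≤ ℓ → hasCycleOfLength (G.induce (S : Set (Fin n))) r


namespace SC

open List

variable {V : Type*}

/-- closed list of distinct vertices forming a cycle -/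
def Cyc (G : SimpleGraph V) (l : List V) : Prop :=
  3 ≤ l.length ∧ l.Nodup ∧ Cycle.Chain G.Adj (l : Cycle V)

/-- same degree function -/
def SameDeg (G H : SimpleGraph V) : Prop :=
  ∀ v, (H.neighborSet v).ncard = (G.neighborSet v).ncard

lemma SameDeg.trans {G H K : SimpleGraph V} (h1 : SameDeg G H) (h2 : SameDeg H K) :
    SameDeg G K := fun v => (h2 v).trans (h1 v)

lemma Cyc.rot {G : SimpleGraph V} {l l' : List V} (h : Cyc G l) (r : l ~r l') : Cyc G l' := by
  obtain ⟨h1, h2, h3⟩ := h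
  refine ⟨by rw [← r.perm.length_eq]; exact h1, r.nodup_iff.1 h2, ?_⟩
  rw [← Cycle.coe_eq_coe.2 r]; exact h3

lemma cyc_iff {G : SimpleGraph V} {h v : V} {s : List V} :
    Cyc G (h :: (s ++ [v])) ↔ s ≠ [] ∧ (h :: (s ++ [v])).Nodup ∧
      IsChain G.Adj (h :: (s ++ [v])) ∧ G.Adj v h := by
  unfold Cyc
  rw [Cycle.chain_coe_cons]
  have : h :: (s ++ [v] ++ [h]) = (h :: s) ++ v :: h :: [] := by simp
  rw [this, isChain_append_cons_cons]
  have h2 : (h :: s) ++ [v] = h :: (s ++ [v]) := rfl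
  rw [h2]
  cases s <;> simp

lemma exists_cons_concat {l : List V} (h : 3 ≤ l.length) :
    ∃ a s b, l = a :: (s ++ [b]) ∧ s ≠ [] := by
  cases l with
  | nil => simp at h
  | cons a t =>
    rcases List.eq_nil_or_concat t with rfl | ⟨s, b, rfl⟩
    · simp at h
    · refine ⟨a, s, b, by simp, ?_⟩
      rintro rfl
      simp at h

lemma rot_last {l : List V} {v : V} (hv : v ∈ l) (h3 : 3 ≤ l.length) :
    ∃ h s, l ~r h :: (s ++ [v]) ∧ s ≠ [] := by
  obtain ⟨a, b, rfl⟩ := List.append_of_mem hv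
  have h1 : (a ++ v :: b) ~r (b ++ (a ++ [v])) := by
    have : a ++ v :: b = (a ++ [v]) ++ b := by simp
    rw [this]; exact isRotated_append
  have h2 : 3 ≤ (b ++ (a ++ [v])).length := by rw [← h1.perm.length_eq]; exact h3
  obtain ⟨x, s, y, hx, hs⟩ := exists_cons_concat h2
  have : y = v := by
    have h5 : (b ++ a) ++ [v] = (x :: s) ++ [y] := by simpa using hx
    have := (List.append_inj' h5 rfl).2
    simpa using this.symm
  subst this
  exact ⟨x, s, by rw [← hx]; exact h1, hs⟩

lemma Cyc.form [DecidableEq V] {G : SimpleGraph V} {l : List V} (hc : Cyc G l) {v : V}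
    (hv : v ∈ l) :
    ∃ s, l ~r (l.formPerm v) :: (s ++ [v]) := by
  obtain ⟨h, s, hr, -⟩ := rot_last hv hc.1
  refine ⟨s, ?_⟩
  have : l.formPerm v = h := by
    rw [formPerm_eq_of_isRotated hc.2.1 hr]
    have := formPerm_cons_concat_apply_last h v s
    simpa using this
  rw [this]; exact hr

lemma formPerm_last [DecidableEq V] {G : SimpleGraph V} {l : List V} (hc : Cyc G l) {h v : V} {s}
    (hr : l ~r h :: (s ++ [v])) : l.formPerm v = h := by
  rw [formPerm_eq_of_isRotated hc.2.1 hr]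
  have := formPerm_cons_concat_apply_last h v s
  simpa using this

lemma Cyc.toWalk {G : SimpleGraph V} {l : List V} (hc : Cyc G l) :
    hasCycleOfLength G l.length := by
  obtain ⟨h, s, v, rfl, hs⟩ := exists_cons_concat hc.1
  obtain ⟨-, hn, hch, hvh⟩ := cyc_iff.1 hc
  obtain ⟨p, hp, hl⟩ : ∃ p : G.Walk h v, p.support = h :: (s ++ [v]) ∧
      p.length = s.length + 1 := by
    have h1 := SimpleGraph.Walk.support_ofSupport (G := G) (by simp) hch
    have h2 := SimpleGraph.Walk.length_ofSupport (G := G) (by simp) hch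
    have e1 : (h :: (s ++ [v])).head (by simp) = h := rfl
    have e2 : (h :: (s ++ [v])).getLast (by simp) = v := by simp
    refine ⟨(SimpleGraph.Walk.ofSupport (G := G) _ (by simp) hch).copy e1 e2, ?_, ?_⟩
    · rw [SimpleGraph.Walk.support_copy]; exact h1
    · rw [SimpleGraph.Walk.length_copy, h2]; simp
  refine ⟨v, SimpleGraph.Walk.cons hvh p, ?_, ?_⟩
  · rw [SimpleGraph.Walk.cons_isCycle_iff]
    have hpath : p.IsPath := by rw [SimpleGraph.Walk.isPath_def, hp]; exact hn
    refine ⟨hpath, fun he => ?_⟩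
    have hlen : 2 ≤ p.length := by
      cases s with
      | nil => exact absurd rfl hs
      | cons a t => simp at hl; omega
    cases p with
    | nil => simp at hlen
    | cons hadj q =>
      rw [SimpleGraph.Walk.cons_isPath_iff] at hpath
      simp only [SimpleGraph.Walk.edges_cons, List.mem_cons] at he
      rcases he with he | he
      · rw [Sym2.eq_iff] at he
        rcases he with ⟨h1, h2⟩ | ⟨h1, h2⟩
        · exact hvh.ne h1
        · subst h1
          have := (SimpleGraph.Walk.isPath_iff_eq_nil).1 hpath.1
          subst this
          simp at hlen
      · exact hpath.2 (SimpleGraph.Walk.snd_mem_support_of_mem_edges _ he)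
  · simp [hl]

lemma Cyc.ofWalk {G : SimpleGraph V} {v : V} {c : G.Walk v v} (hc : c.IsCycle) :
    ∃ l, Cyc G l ∧ l.length = c.length := by
  refine ⟨c.support.tail, ⟨?_, hc.support_nodup, ?_⟩, by simp⟩
  · have := hc.three_le_length
    simpa using this
  · have hne : c.support.tail ≠ [] := by
      have := hc.three_le_length
      intro h
      have h2 : c.support.tail.length = c.length := by simp
      rw [h, List.length_nil] at h2
      omega
    rw [Cycle.chain_ne_nil _ hne]
    have h1 : c.support.tail.getLast hne = v := by
      rw [List.getLast_tail]; simp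
    rw [h1, SimpleGraph.Walk.cons_tail_support]
    exact c.isChain_adj_support

/-- two-switch: remove `ab`, `cd`, add `ac`, `bd`. -/
lemma exists_switch {G : SimpleGraph V} [Finite V] {a b c d : V} (hab : G.Adj a b) (hcd : G.Adj c d)
    (hac : ¬ G.Adj a c) (hbd : ¬ G.Adj b d) (nac : a ≠ c) (nbd : b ≠ d) :
    ∃ H : SimpleGraph V, SameDeg G H ∧ ∀ u v, H.Adj u v ↔
      (G.Adj u v ∧ ¬((u = a ∧ v = b) ∨ (u = b ∧ v = a) ∨ (u = c ∧ v = d) ∨ (u = d ∧ v = c))) ∨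
      ((u = a ∧ v = c) ∨ (u = c ∧ v = a) ∨ (u = b ∧ v = d) ∨ (u = d ∧ v = b)) := by
  classical
  have nab := hab.ne
  have ncd := hcd.ne
  have nad : a ≠ d := by rintro rfl; exact hac hcd.symm
  have nbc : b ≠ c := by rintro rfl; exact hac hab
  refine ⟨⟨fun u v => (G.Adj u v ∧ ¬((u = a ∧ v = b) ∨ (u = b ∧ v = a) ∨ (u = c ∧ v = d) ∨
      (u = d ∧ v = c))) ∨
      ((u = a ∧ v = c) ∨ (u = c ∧ v = a) ∨ (u = b ∧ v = d) ∨ (u = d ∧ v = b)), ?_, ?_⟩, ?_,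
      fun u v => Iff.rfl⟩
  · constructor
    intro u v h
    have := G.adj_comm u v
    tauto
  · constructor
    intro u h
    have := G.irrefl (v := u)
    grind
  · intro v
    by_cases h1 : v = a
    · subst h1
      rw [← Set.ncard_exchange (s := G.neighborSet v) (a := c) (b := b) hac hab]
      congr 1; ext w; simp only [SimpleGraph.mem_neighborSet, Set.mem_insert_iff, Set.mem_sdiff, Set.mem_singleton_iff]; grind
    by_cases h2 : v = b
    · subst h2
      rw [← Set.ncard_exchange (s := G.neighborSet v) (a := d) (b := a) hbd hab.symm]
      congr 1; ext w; simp only [SimpleGraph.mem_neighborSet, Set.mem_insert_iff, Set.mem_sdiff, Set.mem_singleton_iff]; grind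
    by_cases h3 : v = c
    · subst h3
      rw [← Set.ncard_exchange (s := G.neighborSet v) (a := a) (b := d) (fun h => hac h.symm) hcd]
      congr 1; ext w; simp only [SimpleGraph.mem_neighborSet, Set.mem_insert_iff, Set.mem_sdiff, Set.mem_singleton_iff]; grind
    by_cases h4 : v = d
    · subst h4
      rw [← Set.ncard_exchange (s := G.neighborSet v) (a := b) (b := c) (fun h => hbd h.symm) hcd.symm]
      congr 1; ext w; simp only [SimpleGraph.mem_neighborSet, Set.mem_insert_iff, Set.mem_sdiff, Set.mem_singleton_iff]; grind
    congr 1; ext w; simp only [SimpleGraph.mem_neighborSet]; grind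

/-- three-switch: remove `pq`, `xy`, `xz`; add `xp`, `xq`, `yz`. -/
lemma exists_switch3 {G : SimpleGraph V} [Finite V] {p q x y z : V} (hpq : G.Adj p q)
    (hxy : G.Adj x y) (hxz : G.Adj x z) (hyz : ¬ G.Adj y z) (nyz : y ≠ z)
    (hxp : ¬ G.Adj x p) (hxq : ¬ G.Adj x q) (nxp : x ≠ p) (nxq : x ≠ q) :
    ∃ H : SimpleGraph V, SameDeg G H ∧ H.Adj x p ∧ H.Adj x q ∧ H.Adj y z ∧ ∀ u v, G.Adj u v →
      ¬ H.Adj u v →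
      ((u = p ∧ v = q) ∨ (u = q ∧ v = p) ∨ u = x ∨ v = x) := by
  have nyp : y ≠ p := by rintro rfl; exact hxp hxy
  have nyq : y ≠ q := by rintro rfl; exact hxq hxy
  have nzp : z ≠ p := by rintro rfl; exact hxp hxz
  have nzq : z ≠ q := by rintro rfl; exact hxq hxz
  have npq := hpq.ne
  have nxy := hxy.ne
  have nxz := hxz.ne
  by_cases hyq : G.Adj y q
  · obtain ⟨H1, d1, a1⟩ := exists_switch (G := G) (a := y) (b := q) (c := z) (d := x) hyq hxz.symm hyz
      (fun h => hxq h.symm) nyz nxq.symm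
    obtain ⟨H2, d2, a2⟩ := exists_switch (G := H1) (a := p) (b := q) (c := x) (d := y)
      (by rw [a1]; grind) (by rw [a1]; grind) (by rw [a1]; grind [G.adj_comm]) (by rw [a1]; grind)
      nxp.symm nyq.symm
    refine ⟨H2, d1.trans d2, ?_, ?_, ?_, ?_⟩
    · rw [a2]; grind
    · rw [a2, a1]; grind
    · rw [a2, a1]; grind
    · intro u v huv; rw [a2, a1]; grind
  · obtain ⟨H1, d1, a1⟩ := exists_switch (G := G) (a := p) (b := q) (c := x) (d := y) hpq hxy
      (fun h => hxp h.symm) (fun h => hyq h.symm) nxp.symm nyq.symm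
    obtain ⟨H2, d2, a2⟩ := exists_switch (G := H1) (a := y) (b := q) (c := z) (d := x)
      (by rw [a1]; grind) (by rw [a1]; grind [G.adj_comm]) (by rw [a1]; grind) (by rw [a1]; grind [G.adj_comm])
      nyz nxq.symm
    refine ⟨H2, d1.trans d2, ?_, ?_, ?_, ?_⟩
    · rw [a2, a1]; grind
    · rw [a2, a1]; grind
    · rw [a2, a1]; grind
    · intro u v huv; rw [a2, a1]; grind [G.adj_comm]

end SC

namespace SC

open List

variable {V : Type*}

/-- longest cycle among all realizations -/
def MaxC (G : SimpleGraph V) (l : List V) : Prop :=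
  Cyc G l ∧ ∀ H l', SameDeg G H → Cyc H l' → l'.length ≤ l.length

lemma MaxC.rot {G : SimpleGraph V} {l l' : List V} (h : MaxC G l) (r : l ~r l') : MaxC G l' :=
  ⟨h.1.rot r, fun H k hd hc => by rw [← r.perm.length_eq]; exact h.2 H k hd hc⟩

lemma SameDeg.refl (G : SimpleGraph V) : SameDeg G G := fun _ => rfl

lemma MaxC.move {G H : SimpleGraph V} {l l' : List V} (h : MaxC G l) (hd : SameDeg G H)
    (hc : Cyc H l') (hl : l'.length = l.length) : MaxC H l' :=
  ⟨hc, fun K k hk hck => by rw [hl]; exact h.2 K k (hd.trans hk) hck⟩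

lemma chain_pres {G H : SimpleGraph V} {h v : V} {s : List V} (hs : s ≠ [])
    (hn : (h :: (s ++ [v])).Nodup) (hc : IsChain G.Adj (h :: (s ++ [v])))
    (hp : ∀ u w, u ∈ h :: (s ++ [v]) → w ∈ h :: (s ++ [v]) → G.Adj u w → ¬ H.Adj u w →
      (u = v ∧ w = h) ∨ (u = h ∧ w = v)) : IsChain H.Adj (h :: (s ++ [v])) := by
  rw [isChain_iff_getElem] at hc ⊢
  intro i hi
  by_contra hcon
  have hlen : (h :: (s ++ [v])).length = s.length + 2 := by simp
  have hs0 : 0 < s.length := List.length_pos_iff.2 hs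
  have e0 : (h :: (s ++ [v]))[0]'(by simp) = h := rfl
  have e1 : (h :: (s ++ [v]))[s.length + 1]'(by simp) = v := by simp
  rcases hp _ _ (List.getElem_mem _) (List.getElem_mem _) (hc i hi) hcon with ⟨h1, h2⟩ | ⟨h1, h2⟩
  · rw [← e0] at h2
    have := (hn.getElem_inj_iff).1 h2
    omega
  · have h1' := h1.trans e0.symm
    have h2' := h2.trans e1.symm
    have := (hn.getElem_inj_iff).1 h1'
    have := (hn.getElem_inj_iff).1 h2'
    omega

lemma MaxC.extend {G H : SimpleGraph V} {l : List V} (hM : MaxC G l) {h v : V} {s r : List V}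
    (hr : l ~r h :: (s ++ [v])) (hd : SameDeg G H)
    (hp : ∀ u w, u ∈ l → w ∈ l → G.Adj u w → ¬ H.Adj u w → (u = v ∧ w = h) ∨ (u = h ∧ w = v))
    (hr0 : r ≠ []) (hrn : r.Nodup) (hdj : ∀ x ∈ r, x ∉ l) (hrc : IsChain H.Adj (v :: (r ++ [h]))) :
    False := by
  have hM' := hM.rot hr
  obtain ⟨hs, hn, hc, hvh⟩ := cyc_iff.1 hM'.1
  have hc' := chain_pres (H := H) hs hn hc (fun u w hu hw => hp u w (hr.mem_iff.2 hu) (hr.mem_iff.2 hw))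
  have hcy : Cyc H (h :: (s ++ [v] ++ r)) := by
    refine ⟨?_, ?_, ?_⟩
    · simp; have := List.length_pos_iff.2 hs; omega
    · have : h :: (s ++ [v] ++ r) = (h :: (s ++ [v])) ++ r := by simp
      rw [this, List.nodup_append']
      refine ⟨hn, hrn, ?_⟩
      intro x hx hx'
      exact hdj x hx' (hr.mem_iff.2 hx)
    · rw [Cycle.chain_coe_cons]
      have : h :: (s ++ [v] ++ r ++ [h]) = (h :: s) ++ v :: (r ++ [h]) := by simp
      rw [this, isChain_split]
      exact ⟨by simpa using hc', hrc⟩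
  have h1 := hM'.2 H _ hd hcy
  have h2 := List.length_pos_iff.2 hr0
  simp only [List.length_cons, List.length_append] at h1
  omega

section
variable [DecidableEq V] [Finite V] {G : SimpleGraph V} {l : List V}

lemma Cyc.sig_mem (_hM : Cyc G l) {v : V} (hv : v ∈ l) : l.formPerm v ∈ l :=
  formPerm_apply_mem_of_mem hv

lemma Cyc.sig_adj (hM : Cyc G l) {v : V} (hv : v ∈ l) : G.Adj v (l.formPerm v) := by
  obtain ⟨s, hr⟩ := hM.form hv
  exact (cyc_iff.1 (hM.rot hr)).2.2.2

/-- no repeated neighbours along the cycle -/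
lemma F1 (hM : MaxC G l) {v x : V} (hv : v ∈ l) (hx : x ∉ l) (hxv : G.Adj x v) :
    ¬ G.Adj x (l.formPerm v) := by
  intro hxh
  obtain ⟨s, hr⟩ := hM.1.form hv
  refine hM.extend hr (SameDeg.refl G) (fun u w _ _ h1 h2 => absurd h1 h2) (r := [x]) (by simp)
    (by simp) (by simpa using hx) ?_
  simp [hxv.symm, hxh]

lemma F2 (hM : MaxC G l) {v x y : V} (hv : v ∈ l) (hx : x ∉ l) (hxv : G.Adj x v)
    (hxy : G.Adj x y) (hyv : y ≠ v) : G.Adj y v := by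
  by_contra hcon
  have hxh := F1 hM hv hx hxv
  obtain ⟨s, hr⟩ := hM.1.form hv
  have hvh := hM.1.sig_adj hv
  have hh := hM.1.sig_mem hv
  set h := l.formPerm v
  obtain ⟨H, hd, ha⟩ := exists_switch (G := G) (a := h) (b := v) (c := x) (d := y) hvh.symm hxy
    (fun h => hxh h.symm) (fun h => hcon h.symm) (by rintro rfl; exact hx hh) hyv.symm
  refine hM.extend hr hd ?_ (r := [x]) (by simp) (by simp) (by simpa using hx) ?_
  · intro u w hu hw h1 h2
    rw [ha] at h2
    grind
  · have : v ≠ x := by rintro rfl; exact hx hv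
    have := hvh.ne
    have := hxv.symm
    simp [ha]
    grind

lemma F3 (hM : MaxC G l) {v x y z : V} (hv : v ∈ l) (hx : x ∉ l) (hxv : ¬ G.Adj x v)
    (hxh : ¬ G.Adj x (l.formPerm v)) (hxy : G.Adj x y) (hxz : G.Adj x z) (hyz : y ≠ z) :
    G.Adj y z := by
  by_contra hcon
  obtain ⟨s, hr⟩ := hM.1.form hv
  have hvh := hM.1.sig_adj hv
  have hh := hM.1.sig_mem hv
  set h := l.formPerm v
  obtain ⟨H, hd, h1, h2, -, ha⟩ := exists_switch3 hvh hxy hxz hcon hyz hxv hxh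
    (by rintro rfl; exact hx hv) (by rintro rfl; exact hx hh)
  refine hM.extend hr hd ?_ (r := [x]) (by simp) (by simp) (by simpa using hx) ?_
  · intro u w hu hw h3 h4
    have := ha u w h3 h4
    grind
  · simp [h1.symm, h2]

lemma F4 (hM : MaxC G l) {v x y z : V} (hv : v ∈ l) (hx : x ∉ l) (hy : y ∉ l) (hz : z ∉ l)
    (hxy : G.Adj x y) (hzx : G.Adj z x) (hzy : G.Adj z y) (hvx : ¬ G.Adj v x)
    (hhy : ¬ G.Adj (l.formPerm v) y) : False := by
  obtain ⟨s, hr⟩ := hM.1.form hv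
  have hvh := hM.1.sig_adj hv
  have hh := hM.1.sig_mem hv
  set h := l.formPerm v
  obtain ⟨H, hd, ha⟩ := exists_switch (G := G) (a := v) (b := h) (c := x) (d := y) hvh hxy
    hvx hhy (by rintro rfl; exact hx hv) (by rintro rfl; exact hy hh)
  have := hxy.ne
  have := hzx.ne
  have := hzy.ne
  have := hzx.symm
  refine hM.extend hr hd ?_ (r := [x, z, y]) (by simp) (by grind) (by grind) ?_
  · intro u w hu hw h1 h2
    rw [ha] at h2
    grind
  · simp [ha]
    grind

lemma F5 (hM : MaxC G l) {x y z : V} (hx : x ∉ l) (hxy : G.Adj x y) (hxz : G.Adj x z)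
    (hyz : y ≠ z) : ∃ q ∈ l, G.Adj x q := by
  by_contra! hcon
  have hy : y ∉ l := fun h => hcon y h hxy
  have hz : z ∉ l := fun h => hcon z h hxz
  obtain ⟨v, hv⟩ : ∃ v, v ∈ l := by
    have := hM.1.1
    cases l with
    | nil => simp at this
    | cons a t => exact ⟨a, by simp⟩
  have key : ∀ v ∈ l, G.Adj (l.formPerm v) y := by
    intro v hv
    by_contra h
    have hyz' := F3 hM hv hx (hcon v hv) (hcon _ (hM.1.sig_mem hv)) hxy hxz hyz
    exact F4 hM hv hx hy hz hxy hxz.symm hyz'.symm (fun h => hcon v hv h.symm) h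
  have h1 := key v hv
  have h2 := key _ (hM.1.sig_mem hv)
  exact F1 hM (hM.1.sig_mem hv) hy h1.symm h2.symm

/-- rotate to expose three consecutive vertices -/
lemma Cyc.form3 (hc : Cyc G l) {q : V} (hq : q ∈ l) :
    ∃ t, l ~r l.formPerm (l.formPerm q) :: (t ++ [q, l.formPerm q]) := by
  obtain ⟨s, hr⟩ := hc.form (hc.sig_mem hq)
  set h1 := l.formPerm q with hh1
  set h2 := l.formPerm h1
  obtain ⟨hs, -⟩ := cyc_iff.1 (hc.rot hr)
  obtain ⟨t, b, rfl⟩ := (List.eq_nil_or_concat s).resolve_left hs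
  refine ⟨t, ?_⟩
  have : l.formPerm b = h1 := by
    apply formPerm_last hc (s := h2 :: t)
    refine hr.trans ?_
    have : h2 :: (t.concat b ++ [h1]) = (h2 :: (t ++ [b])) ++ [h1] := by simp
    rw [this]
    exact isRotated_append
  have : b = q := (l.formPerm).injective (this.trans hh1)
  subst this
  simpa using hr

lemma F6a (hM : MaxC G l) {x y q : V} (hx : x ∉ l) (hy : y ∉ l) (hxy : G.Adj x y) (hq : q ∈ l)
    (hxq : G.Adj x q) : ¬ G.Adj x (l.formPerm (l.formPerm q)) := by
  intro hx2
  obtain ⟨t, hr⟩ := hM.1.form3 hq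
  have m1 := hM.1.sig_mem hq
  have m2 := hM.1.sig_mem m1
  set h1 := l.formPerm q
  set h2 := l.formPerm h1
  have hy2 : G.Adj y h2 := F2 hM m2 hx hx2 hxy (by rintro rfl; exact hy m2)
  obtain ⟨h3, hn, hch⟩ := hM.1.rot hr
  have hM' := hM.rot hr
  have hx' : x ∉ h2 :: (t ++ [q, h1]) := fun h => hx (hr.mem_iff.2 h)
  have hy' : y ∉ h2 :: (t ++ [q, h1]) := fun h => hy (hr.mem_iff.2 h)
  have hcy : Cyc G (h2 :: (t ++ [q, x, y])) := by
    refine ⟨by simp, ?_, ?_⟩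
    · have := hxy.ne
      simp [List.nodup_append] at hn hx' hy' ⊢
      grind
    · rw [Cycle.chain_coe_cons] at hch ⊢
      have e1 : h2 :: (t ++ [q, h1] ++ [h2]) = (h2 :: t) ++ q :: [h1, h2] := by simp
      have e2 : h2 :: (t ++ [q, x, y] ++ [h2]) = (h2 :: t) ++ q :: [x, y, h2] := by simp
      rw [e1, isChain_split] at hch
      rw [e2, isChain_split]
      refine ⟨hch.1, ?_⟩
      simp [hxq.symm, hxy, hy2]
  have := hM'.2 G _ (SameDeg.refl G) hcy
  simp at this

lemma F6 (hM : MaxC G l) {x y z : V} (hx : x ∉ l) (hy : y ∉ l) (hz : z ∉ l) (hxy : G.Adj x y)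
    (hxz : G.Adj x z) : y = z := by
  by_contra hyz
  obtain ⟨q, hq, hxq⟩ := F5 hM hx hxy hxz hyz
  have h1x := F1 hM hq hx hxq
  have h2x := F6a hM hx hy hxy hq hxq
  have m1 := hM.1.sig_mem hq
  have m2 := hM.1.sig_mem m1
  have hyz' := F3 hM m1 hx h1x h2x hxy hxz hyz
  refine F4 hM m1 hx hy hz hxy hxz.symm hyz'.symm (fun h => h1x h.symm) (fun h => h2x ?_)
  exact F2 hM m2 hy h.symm hxy.symm (by rintro rfl; exact hx m2)

lemma F7 (hM : MaxC G l) {x y q : V} (hx : x ∉ l) (hy : y ∉ l) (hxy : G.Adj x y) (hq : q ∈ l)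
    (hxq : G.Adj x q) :
    (G.neighborSet (l.formPerm q)).ncard ≤ (G.neighborSet x).ncard := by
  have h1x := F1 hM hq hx hxq
  have h2x := F6a hM hx hy hxy hq hxq
  have m1 := hM.1.sig_mem hq
  have m2 := hM.1.sig_mem m1
  have hqy : G.Adj y q := F2 hM hq hx hxq hxy (by rintro rfl; exact hy hq)
  have h2y : ¬ G.Adj y (l.formPerm (l.formPerm q)) := fun h => h2x
    (F2 hM m2 hy h hxy.symm (by rintro rfl; exact hx m2))
  have h12 := hM.1.sig_adj m1
  obtain ⟨t, hr⟩ := hM.1.form3 hq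
  set h1 := l.formPerm q
  set h2 := l.formPerm h1
  obtain ⟨H, hd, ha⟩ := exists_switch (G := G) (a := h1) (b := h2) (c := x) (d := y) h12 hxy
    (fun h => h1x h.symm) (fun h => h2y h.symm) (by rintro rfl; exact hx m1)
    (by rintro rfl; exact hy m2)
  obtain ⟨h3, hn, hch⟩ := hM.1.rot hr
  have hx' : x ∉ h2 :: (t ++ [q, h1]) := fun h => hx (hr.mem_iff.2 h)
  have hy' : y ∉ h2 :: (t ++ [q, h1]) := fun h => hy (hr.mem_iff.2 h)
  have hcy : Cyc H (h2 :: (t ++ [q, y])) := by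
    refine ⟨by simp, ?_, ?_⟩
    · simp [List.nodup_append] at hn hx' hy' ⊢
      grind
    · rw [Cycle.chain_coe_cons] at hch ⊢
      have e1 : h2 :: (t ++ [q, h1] ++ [h2]) = (h2 :: t) ++ q :: [h1, h2] := by simp
      have e2 : h2 :: (t ++ [q, y] ++ [h2]) = (h2 :: t) ++ q :: [y, h2] := by simp
      rw [e1, isChain_split] at hch
      rw [e2, isChain_split]
      refine ⟨?_, ?_⟩
      · refine (IsChain.iff_of_mem_imp ?_).1 hch.1
        intro u w hu hw
        have hu1 : u ≠ h1 := by rintro rfl; simp [List.nodup_append] at hn hu; grind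
        have hw1 : w ≠ h1 := by rintro rfl; simp [List.nodup_append] at hn hw; grind
        have hux : u ≠ x := by rintro rfl; apply hx'; simp at hu ⊢; grind
        have hwx : w ≠ x := by rintro rfl; apply hx'; simp at hw ⊢; grind
        have huy : u ≠ y := by rintro rfl; apply hy'; simp at hu ⊢; grind
        have hwy : w ≠ y := by rintro rfl; apply hy'; simp at hw ⊢; grind
        rw [ha]
        grind
      · have : q ≠ h1 := (hM.1.sig_adj hq).ne
        have : q ≠ x := by rintro rfl; exact hx hq
        have : q ≠ y := by rintro rfl; exact hy hq
        simp [ha]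
        have := hqy.symm
        grind
  have hMH : MaxC H (h2 :: (t ++ [q, y])) := hM.move hd hcy (by
    rw [hr.perm.length_eq]; simp)
  have hx1 : x ≠ h1 := by rintro rfl; exact hx m1
  have hxN : x ∉ h2 :: (t ++ [q, y]) := by
    have := hxy.ne
    simp at hx' ⊢; grind
  have h1N : h1 ∉ h2 :: (t ++ [q, y]) := by
    have : h1 ≠ y := by rintro rfl; exact hy m1
    simp [List.nodup_append] at hn ⊢; grind
  have hadj : H.Adj h1 x := by rw [ha]; grind
  have hsub : H.neighborSet h1 \ {x} ⊆ H.neighborSet x \ {h1} := by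
    intro w hw
    simp only [Set.mem_sdiff, SimpleGraph.mem_neighborSet, Set.mem_singleton_iff] at hw ⊢
    have hwl : w ∈ h2 :: (t ++ [q, y]) := by
      by_contra hwl
      exact hw.2 (F6 hMH h1N hwl hxN hw.1 hadj)
    exact ⟨F2 hMH hwl h1N hw.1 hadj (fun h => hw.2 h.symm), hw.1.ne'⟩
  rw [← hd h1, ← hd x]
  have e1 := Set.ncard_sdiff_singleton_add_one (s := H.neighborSet h1) (a := x) hadj
  have e2 := Set.ncard_sdiff_singleton_add_one (s := H.neighborSet x) (a := h1) hadj.symm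
  have := Set.ncard_le_ncard hsub
  omega

end

end SC

namespace SC

open List

variable {V : Type*}

lemma cross_cyc {G : SimpleGraph V} {P1 P2 : List V} {u w a b : V}
    (hn : (P1 ++ P2).Nodup) (hc : IsChain G.Adj (P1 ++ P2)) (h3 : 3 ≤ (P1 ++ P2).length)
    (h0 : P1.head? = some u) (h1 : P1.getLast? = some a) (h2 : P2.head? = some b)
    (h4 : P2.getLast? = some w) (hub : G.Adj u b) (hwa : G.Adj w a) :
    Cyc G (P1 ++ P2.reverse) := by
  refine ⟨by simpa using h3, ?_, ?_⟩
  · exact (List.Perm.append_left P1 (List.reverse_perm P2)).nodup_iff.2 hn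
  · have hne : P1 ++ P2.reverse ≠ [] := by
      intro h
      simp at h
      simp [h.1] at h0
    rw [Cycle.chain_ne_nil _ hne]
    have : (P1 ++ P2.reverse).getLast hne = b := by
      have : (P1 ++ P2.reverse).getLast? = some b := by
        simp [h2]
      rw [List.getLast?_eq_getLast_of_ne_nil hne] at this
      simpa using this
    rw [this]
    rw [isChain_append] at hc
    rw [← List.cons_append, isChain_append, List.isChain_reverse]
    refine ⟨?_, ?_, ?_⟩
    · cases P1 with
      | nil => simp at h0
      | cons c t =>
        simp at h0
        subst h0
        exact IsChain.cons_cons hub.symm hc.1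
    · refine (IsChain.iff_of_mem_imp ?_).1 hc.2.1
      intro x y _ _
      exact G.adj_comm x y
    · intro x hx y hy
      have : P1 ≠ [] := by rintro rfl; simp at h0
      simp [List.getLast?_cons, h1] at hx
      simp [h4] at hy
      subst hx; subst hy
      exact hwa.symm

lemma cross [DecidableEq V] {G : SimpleGraph V} [DecidableRel G.Adj] {P : List V} {u w : V}
    (hP : P.Nodup) (hc : IsChain G.Adj P)
    (h0 : P.head? = some u) (hl : P.getLast? = some w) (h3 : 3 ≤ P.length)
    (hno : ∀ l', Cyc G l' → l'.length < P.length) (S : Finset V) (hS : ∀ z ∈ S, z ∈ P) :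
    (S.filter (G.Adj u)).card + (S.filter (G.Adj w)).card ≤ P.length - 1 := by
  classical
  have g0 : P[0]'(by omega) = u := by
    rw [List.head?_eq_getElem?, List.getElem?_eq_getElem (by omega)] at h0
    simpa using h0
  have g1 : P[P.length - 1]'(by omega) = w := by
    rw [List.getLast?_eq_getElem?, List.getElem?_eq_getElem (by omega)] at hl
    simpa using hl
  let I := (Finset.range (P.length - 1)).filter (fun i => G.Adj u (P.getD (i + 1) u))
  let J := (Finset.range (P.length - 1)).filter (fun i => G.Adj w (P.getD i u))
  have hI : (S.filter (G.Adj u)).card ≤ I.card := by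
    refine le_trans (Finset.card_le_card (t := I.image (fun i => P.getD (i + 1) u)) ?_)
      Finset.card_image_le
    intro z hz
    rw [Finset.mem_filter] at hz
    obtain ⟨k, hk, rfl⟩ := List.getElem_of_mem (hS z hz.1)
    have hk0 : k ≠ 0 := by
      rintro rfl
      rw [g0] at hz
      exact hz.2.ne rfl
    obtain ⟨i, rfl⟩ := Nat.exists_eq_succ_of_ne_zero hk0
    rw [Finset.mem_image]
    refine ⟨i, ?_, by simp [hk]⟩
    simp only [I, Finset.mem_filter, Finset.mem_range]
    refine ⟨by omega, ?_⟩
    simpa [hk] using hz.2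
  have hJ : (S.filter (G.Adj w)).card ≤ J.card := by
    refine le_trans (Finset.card_le_card (t := J.image (fun i => P.getD i u)) ?_)
      Finset.card_image_le
    intro z hz
    rw [Finset.mem_filter] at hz
    obtain ⟨k, hk, rfl⟩ := List.getElem_of_mem (hS z hz.1)
    have hk0 : k ≠ P.length - 1 := by
      rintro rfl
      rw [g1] at hz
      exact hz.2.ne rfl
    rw [Finset.mem_image]
    refine ⟨k, ?_, by simp [hk]⟩
    simp only [J, Finset.mem_filter, Finset.mem_range]
    refine ⟨by omega, ?_⟩
    simpa [hk] using hz.2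
  have hdis : Disjoint I J := by
    rw [Finset.disjoint_left]
    intro i hi hj
    simp only [I, J, Finset.mem_filter, Finset.mem_range] at hi hj
    have hi1 : i + 1 < P.length := by omega
    have hi0 : i < P.length := by omega
    have ha := hi.2
    have hb := hj.2
    rw [List.getD_eq_getElem _ _ hi1] at ha
    rw [List.getD_eq_getElem _ _ hi0] at hb
    have e : P.take (i + 1) ++ P.drop (i + 1) = P := List.take_append_drop _ _
    have hcy : Cyc G (P.take (i + 1) ++ (P.drop (i + 1)).reverse) := by
      refine cross_cyc (u := u) (w := w) (a := P[i]) (b := P[i + 1]) (by rw [e]; exact hP)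
        (by rw [e]; exact hc) (by rw [e]; exact h3) ?_ ?_ ?_ ?_ ha hb
      · rw [List.head?_take]; simp [h0]
      · rw [List.getLast?_take]; simp [hi0]
      · rw [List.head?_drop]; simp [hi1]
      · rw [List.getLast?_drop]; simp [hl]; omega
    have := hno _ hcy
    simp at this
    omega
  have : (I ∪ J).card ≤ P.length - 1 := by
    rw [← Finset.card_range (P.length - 1)]
    apply Finset.card_le_card
    apply Finset.union_subset <;> exact Finset.filter_subset _ _
  rw [Finset.card_union_of_disjoint hdis] at this
  omega

lemma cross_main [DecidableEq V] [Finite V] {G : SimpleGraph V} [DecidableRel G.Adj] {l : List V}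
    (hM : MaxC G l) {x v1 v2 : V} (hx : x ∉ l) (h1 : v1 ∈ l) (h2 : v2 ∈ l) (h12 : v1 ≠ v2)
    (hx1 : G.Adj x v1) (hx2 : G.Adj x v2) :
    (l.toFinset.filter (G.Adj (l.formPerm v1))).card +
      (l.toFinset.filter (G.Adj (l.formPerm v2))).card ≤ l.length := by
  obtain ⟨s, hr⟩ := hM.1.form h1
  set u := l.formPerm v1
  have hM' := hM.rot hr
  obtain ⟨hs, hn, hch, hvh⟩ := cyc_iff.1 hM'.1
  have h2' : v2 ∈ u :: s := by
    have := hr.mem_iff.1 h2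
    simp at this ⊢
    rcases this with h | h | h
    · exact Or.inl h
    · exact Or.inr h
    · exact absurd h.symm h12
  obtain ⟨a, b, hab⟩ := List.append_of_mem h2'
  have e : u :: (s ++ [v1]) = (a ++ [v2]) ++ (b ++ [v1]) := by
    have : u :: (s ++ [v1]) = (u :: s) ++ [v1] := rfl
    rw [this, hab]; simp
  obtain ⟨w, b', hb⟩ : ∃ w b', b ++ [v1] = w :: b' := by
    cases b with
    | nil => exact ⟨_, _, rfl⟩
    | cons c t => exact ⟨_, _, rfl⟩
  have hw : l.formPerm v2 = w := by
    apply formPerm_last hM.1 (s := b' ++ a)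
    refine hr.trans ?_
    rw [e, hb]
    have : w :: (b' ++ a ++ [v2]) = (w :: b') ++ (a ++ [v2]) := by simp
    rw [this]
    exact isRotated_append
  rw [hw]
  have hxu : x ∉ (a ++ [v2]) ++ (b ++ [v1]) := by
    rw [← e]; exact fun h => hx (hr.mem_iff.2 h)
  rw [e] at hn hch hr
  have hlen : l.length = ((a ++ [v2]) ++ (b ++ [v1])).length := hr.perm.length_eq
  have key := cross (G := G) (P := (a ++ [v2]) ++ x :: (b ++ [v1]).reverse) (u := u) (w := w) ?_ ?_ ?_ ?_ ?_ ?_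
    l.toFinset ?_
  · refine key.trans ?_
    rw [hlen]; simp
  · have : ((a ++ [v2]) ++ x :: (b ++ [v1]).reverse).Perm (x :: ((a ++ [v2]) ++ (b ++ [v1]))) := by
      refine List.perm_middle.trans (List.Perm.cons _ ?_)
      exact List.Perm.append_left _ (List.reverse_perm _)
    rw [this.nodup_iff]
    exact List.nodup_cons.2 ⟨hxu, hn⟩
  · rw [isChain_append] at hch
    rw [isChain_append]
    refine ⟨hch.1, ?_, ?_⟩
    · have : IsChain G.Adj (b ++ [v1]).reverse := by
        rw [List.isChain_reverse]
        refine (IsChain.iff_of_mem_imp ?_).1 hch.2.1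
        intro x y _ _
        exact G.adj_comm x y
      simp only [List.reverse_append, List.reverse_cons, List.reverse_nil, List.nil_append,
        List.singleton_append] at this ⊢
      exact IsChain.cons_cons hx1 this
    · intro p hp q hq
      simp at hp hq
      subst hp; subst hq; exact hx2.symm
  · have := congrArg List.head? e
    cases a <;> simp at this ⊢ <;> exact this.symm
  · have : (a ++ [v2]) ++ x :: (b ++ [v1]).reverse = ((a ++ [v2]) ++ x :: b'.reverse) ++ [w] := by
      rw [hb]; simp
    rw [this]
    exact List.getLast?_concat
  · simp
    have := hM.1.1
    rw [hlen] at this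
    simp at this
    omega
  · intro l' hl'
    have := hM.2 G l' (SameDeg.refl G) hl'
    rw [hlen] at this
    simp at this ⊢
    omega
  · intro z hz
    have := hr.mem_iff.1 (List.mem_toFinset.1 hz)
    simp at this ⊢
    tauto

end SC

namespace SC

open List

variable {V : Type*}

lemma Cyc.form4 [DecidableEq V] {G : SimpleGraph V} {l : List V} (hc : Cyc G l)
    (h5 : 5 ≤ l.length) {q : V} (hq : q ∈ l) :
    ∃ a b c t, t ≠ [] ∧ l ~r q :: a :: b :: c :: t ∧ l.formPerm q = a ∧ l.formPerm a = b ∧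
      l.formPerm b = c ∧ (q :: a :: b :: c :: t).Nodup ∧ G.Adj q a ∧ G.Adj a b ∧ G.Adj b c ∧
      IsChain G.Adj (c :: (t ++ [q])) := by
  obtain ⟨r, s, rfl⟩ := List.append_of_mem hq
  have hr : (r ++ q :: s) ~r q :: (s ++ r) := by
    have : q :: (s ++ r) = (q :: s) ++ r := by simp
    rw [this]; exact isRotated_append
  have hlen := hr.perm.length_eq
  rcases hL : s ++ r with _ | ⟨a, _ | ⟨b, _ | ⟨c, t⟩⟩⟩
  · rw [hL] at hlen; rw [hlen] at h5; simp at h5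
  · rw [hL] at hlen; rw [hlen] at h5; simp at h5
  · rw [hL] at hlen; rw [hlen] at h5; simp at h5
  · rw [hL] at hlen hr
    have hc' := hc.rot hr
    obtain ⟨-, hn, hch⟩ := hc'
    rw [Cycle.chain_coe_cons] at hch
    have hf : (r ++ q :: s).formPerm = (q :: a :: b :: c :: t).formPerm :=
      formPerm_eq_of_isRotated hc.2.1 hr
    have f := fun i (hi : i + 1 < (q :: a :: b :: c :: t).length) =>
      formPerm_apply_lt_getElem _ hn i hi
    refine ⟨a, b, c, t, ?_, hr, ?_, ?_, ?_, hn, ?_⟩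
    · rintro rfl
      rw [hlen] at h5; simp at h5
    · rw [hf]; exact f 0 (by simp)
    · rw [hf]; exact f 1 (by simp)
    · rw [hf]; exact f 2 (by simp)
    · simpa using hch

lemma drop_cyc {H : SimpleGraph V} {q a b c : V} {t : List V}
    (hn : (q :: a :: b :: c :: t).Nodup) (h1 : H.Adj q b) (h2 : H.Adj b c)
    (h3 : IsChain H.Adj (c :: (t ++ [q]))) : Cyc H (q :: b :: c :: t) := by
  refine ⟨by simp, ?_, ?_⟩
  · simp at hn ⊢; tauto
  · rw [Cycle.chain_coe_cons]
    simpa [h1, h2] using h3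

lemma shorten [Finite V] {G : SimpleGraph V} {l : List V} (hc : Cyc G l) (h6 : 6 ≤ l.length)
    (hdeg : ∃ w, 3 ≤ (G.neighborSet w).ncard) :
    ∃ H l', SameDeg G H ∧ Cyc H l' ∧ l'.length + 1 = l.length := by
  classical
  by_contra! hno
  have N1 : ∀ q ∈ l, ¬ G.Adj q (l.formPerm (l.formPerm q)) := by
    intro q hq hadj
    obtain ⟨a, b, c, t, ht, hr, rfl, rfl, rfl, hn, h1, h2, h3, hch⟩ := hc.form4 (by omega) hq
    refine hno G _ (SameDeg.refl G) (drop_cyc hn hadj h3 hch) ?_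
    rw [hr.perm.length_eq]; simp
  have N2 : ∀ q ∈ l, ∀ y, y ≠ l.formPerm q → y ≠ l.formPerm (l.formPerm (l.formPerm q)) →
      G.Adj y (l.formPerm (l.formPerm q)) → G.Adj y (l.formPerm q) := by
    intro q hq y hy1 hy2 hadj
    by_contra hcon
    have hn1 := N1 q hq
    obtain ⟨a, b, c, t, ht, hr, ha, hb, hcc, hn, h1, h2, h3, hch⟩ := hc.form4 (by omega) hq
    rw [ha, hb] at hn1 hadj
    rw [ha] at hcon hy1
    rw [ha, hb, hcc] at hy2
    have nqb : q ≠ b := by simp at hn; tauto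
    obtain ⟨H, hd, hH⟩ := exists_switch (G := G) (a := q) (b := a) (c := b) (d := y) h1 hadj.symm hn1
      (fun h => hcon h.symm) nqb hy1.symm
    refine hno H _ hd (drop_cyc hn ?_ ?_ ?_) ?_
    · rw [hH]; simp
    · rw [hH]; simp at hn; grind
    · refine (IsChain.iff_of_mem_imp ?_).1 hch
      intro u w hu hw
      have hu1 : u ≠ a ∧ u ≠ b := by simp at hu hn; grind
      have hw1 : w ≠ a ∧ w ≠ b := by simp at hw hn; grind
      rw [hH]; grind
    · rw [hr.perm.length_eq]; simp
  have hmem : ∀ {q}, q ∈ l → l.formPerm q ∈ l := fun hq => hc.sig_mem hq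
  have hsurj : ∀ z ∈ l, ∃ w ∈ l, l.formPerm w = z := by
    intro z hz
    refine ⟨(l.formPerm)⁻¹ z, ?_, by simp⟩
    rw [← formPerm_mem_iff_mem]
    simpa using hz
  -- no chords
  have N3 : ∀ y ∈ l, ∀ i, 2 ≤ i → i + 2 ≤ l.length → ¬ G.Adj y ((l.formPerm ^ i) y) := by
    intro y hy i hi
    have hpow : ∀ j, 0 < j → j < l.length → (l.formPerm ^ j) y ≠ y := by
      intro j hj0 hj hcon
      obtain ⟨k, hk, rfl⟩ := List.getElem_of_mem hy
      rw [formPerm_pow_apply_getElem _ hc.2.1] at hcon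
      have := (hc.2.1.getElem_inj_iff).1 hcon
      have h1 : (k + j) % l.length = k % l.length := by rw [this, Nat.mod_eq_of_lt hk]
      have h2 := Nat.ModEq.add_left_cancel' (a := j) (b := 0) k (n := l.length) h1
      have h3 : j % l.length = 0 := by simpa [Nat.ModEq] using h2
      rw [Nat.mod_eq_of_lt hj] at h3
      omega
    induction i, hi using Nat.le_induction with
    | base =>
      intro _ h
      exact N1 y hy (by simpa [pow_succ] using h)
    | succ i hi ih =>
      intro hle h
      obtain ⟨j, rfl⟩ : ∃ j, i = j + 1 := ⟨i - 1, by omega⟩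
      have hm : (l.formPerm ^ j) y ∈ l := by
        clear hi ih hle h
        induction j with
        | zero => simpa using hy
        | succ j ih => rw [pow_succ', Equiv.Perm.mul_apply]; exact hmem ih
      have e : ∀ k, (l.formPerm ^ (k + 1)) y = l.formPerm ((l.formPerm ^ k) y) := by
        intro k; rw [pow_succ', Equiv.Perm.mul_apply]
      apply ih (by omega)
      have := N2 _ hm y
      rw [← e, ← e, ← e] at this
      exact this (hpow _ (by omega) (by omega)).symm (hpow _ (by omega) (by omega)).symm h
  have N3' : ∀ y ∈ l, ∀ z ∈ l, G.Adj y z → z = l.formPerm y ∨ y = l.formPerm z := by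
    intro y hy z hz hadj
    obtain ⟨k, hk, hk'⟩ := List.getElem_of_mem hy
    obtain ⟨k2, hk2, hk2'⟩ := List.getElem_of_mem hz
    have hpw : ∀ j, (l.formPerm ^ j) y = l[(k + j) % l.length]'(Nat.mod_lt _ (by omega)) := by
      intro j; rw [← hk', formPerm_pow_apply_getElem _ hc.2.1]
    obtain ⟨i, hi, hiz⟩ : ∃ i, i < l.length ∧ (l.formPerm ^ i) y = z := by
      refine ⟨(k2 + (l.length - k)) % l.length, Nat.mod_lt _ (by omega), ?_⟩
      rw [hpw, ← hk2']
      congr 1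
      rw [Nat.add_mod_mod]
      have : k + (k2 + (l.length - k)) = k2 + l.length := by omega
      rw [this, Nat.add_mod_right, Nat.mod_eq_of_lt hk2]
    by_cases i0 : i = 0
    · subst i0; simp at hiz; exact absurd hiz hadj.ne
    by_cases i1 : i = 1
    · subst i1; left; simpa using hiz.symm
    by_cases i2 : i + 2 ≤ l.length
    · exact absurd (hiz ▸ hadj) (N3 y hy i (by omega) i2)
    · right
      have : l.formPerm z = (l.formPerm ^ l.length) y := by
        have hh : l.length = i + 1 := by omega
        rw [hh, pow_succ', Equiv.Perm.mul_apply, hiz]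
      rw [this, hpw]
      have : (k + l.length) % l.length = k := by rw [Nat.add_mod_right, Nat.mod_eq_of_lt hk]
      simp only [this]
      exact hk'.symm
  have N4 : ∀ y, y ∉ l → ∀ z ∈ l, ¬ G.Adj y z := by
    intro y hy z hz hadj
    obtain ⟨z3, hz3, rfl⟩ := hsurj z hz
    obtain ⟨z2, hz2, rfl⟩ := hsurj z3 hz3
    have a1 := N2 z2 hz2 y (by rintro rfl; exact hy hz3)
      (by rintro rfl; exact hy (hmem hz)) hadj
    obtain ⟨z1, hz1, rfl⟩ := hsurj z2 hz2
    have a2 := N2 z1 hz1 y (by rintro rfl; exact hy hz2) (by rintro rfl; exact hy hz) a1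
    obtain ⟨z0, hz0, rfl⟩ := hsurj z1 hz1
    have a3 := N2 z0 hz0 y (by rintro rfl; exact hy hz1) (by rintro rfl; exact hy hz3) a2
    obtain ⟨a, b, c, t, ht, hr, ha, hb, hcc, hn, h1, h2, h3, hch⟩ := hc.form4 (by omega) hz1
    rw [ha, hb, hcc] at hadj
    set z1 := l.formPerm z0
    have hy' : y ∉ z1 :: a :: b :: c :: t := fun h => hy (hr.mem_iff.2 h)
    refine hno G (y :: c :: (t ++ [z1])) (SameDeg.refl G) ⟨by simp, ?_, ?_⟩ ?_
    · have : (y :: c :: (t ++ [z1])).Perm (y :: z1 :: c :: t) := by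
        refine List.Perm.cons _ ?_
        have := List.perm_append_comm (l₁ := c :: t) (l₂ := [z1])
        simpa using this
      rw [this.nodup_iff]
      simp at hn hy' ⊢
      tauto
    · rw [Cycle.chain_coe_cons]
      have e : y :: (c :: (t ++ [z1]) ++ [y]) = (y :: c :: t) ++ z1 :: y :: [] := by simp
      rw [e, isChain_append_cons_cons]
      refine ⟨?_, a3.symm, by simp⟩
      have := IsChain.cons_cons hadj hch
      simpa using this
    · rw [hr.perm.length_eq]; simp
  obtain ⟨w, hw⟩ := hdeg
  have hwl : w ∉ l := by
    intro hwl
    obtain ⟨p, hp, hpw⟩ := hsurj w hwl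
    have hsub : G.neighborSet w ⊆ {l.formPerm w, p} := by
      intro z hz
      have hz' : G.Adj w z := hz
      have hzl : z ∈ l := by
        by_contra hzl
        exact N4 z hzl w hwl hz'.symm
      rcases N3' w hwl z hzl hz' with h | h
      · left; exact h
      · right
        exact (l.formPerm).injective (h.symm.trans hpw.symm)
    have := Set.ncard_le_ncard hsub
    have h8 := Set.ncard_insert_le (l.formPerm w) {p}
    rw [Set.ncard_singleton] at h8
    omega
  obtain ⟨b', hb'⟩ : (G.neighborSet w).Nonempty := by
    apply Set.nonempty_of_ncard_ne_zero; omega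
  have hwb : G.Adj w b' := hb'
  have hbl : b' ∉ l := fun h => N4 w hwl b' h hwb
  obtain ⟨q, hq⟩ : ∃ q, q ∈ l := by
    cases l with
    | nil => simp at h6
    | cons a t => exact ⟨a, by simp⟩
  have hn1 := N1 q hq
  have hma := hmem hq
  obtain ⟨a, b, c, t, ht, hr, ha, hb, hcc, hn, h1, h2, h3, hch⟩ := hc.form4 (by omega) hq
  rw [ha] at hma
  rw [ha, hb] at hn1
  have hwl' : w ∉ q :: a :: b :: c :: t := fun h => hwl (hr.mem_iff.2 h)
  have hbl' : b' ∉ q :: a :: b :: c :: t := fun h => hbl (hr.mem_iff.2 h)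
  obtain ⟨H, hd, -, -, hqb, hH⟩ := exists_switch3 (p := w) (q := b') (x := a) (y := q) (z := b)
    hwb h1.symm h2 hn1 (by simp at hn; tauto) (fun h => N4 w hwl a hma h.symm)
    (fun h => N4 b' hbl a hma h.symm) (by rintro rfl; exact hwl hma) (by rintro rfl; exact hbl hma)
  refine hno H _ hd (drop_cyc hn hqb ?_ ?_) ?_
  · by_contra hcon
    have := hH b c h3 hcon
    simp at hn hwl' hbl'
    grind
  · refine IsChain.imp_of_mem_imp ?_ hch
    intro u v hu hv huv
    by_contra hcon
    have := hH u v huv hcon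
    simp at hn hwl' hbl' hu hv
    grind
  · rw [hr.perm.length_eq]; simp

lemma shorten_to [Finite V] {G : SimpleGraph V} (hdeg : ∃ w, 3 ≤ (G.neighborSet w).ncard)
    (k : ℕ) (hk : 5 ≤ k) (N : ℕ) : ∀ (H : SimpleGraph V) (l : List V), SameDeg G H → Cyc H l →
      l.length = k + N → ∃ H' l', SameDeg G H' ∧ Cyc H' l' ∧ l'.length = k := by
  induction N with
  | zero => intro H l hd hc hl; exact ⟨H, l, hd, hc, hl⟩
  | succ N ih =>
    intro H l hd hc hl
    obtain ⟨H', l', hd', hc', hl'⟩ := shorten hc (by omega)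
      (by obtain ⟨w, hw⟩ := hdeg; exact ⟨w, by rw [hd w]; exact hw⟩)
    exact ih H' l' (hd.trans hd') hc' (by omega)

end SC

namespace SC

open List

lemma num1 {m n c N S e : ℤ} (hc : 3 ≤ c) (hcm : c ≤ 2 * m) (hN : N + c = n)
    (he : e + c ≤ c * c) (hS : S ≤ e + 2 * 1 * N) : S + 6 * m ≤ 2 * n + 4 * m ^ 2 := by
  nlinarith [mul_nonneg (sub_nonneg.2 hcm) (by linarith : 0 ≤ 2 * m + c - 3)]

lemma convex_aux {m j A B g K : ℤ} (hj : 1 ≤ j) (hjm : j ≤ m) (hm : 2 ≤ m)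
    (hK : 0 ≤ K) (h : (m - 1) * g + K ≤ (m - j) * A + (j - 1) * B) : g ≤ A ∨ g ≤ B := by
  by_contra! hcon
  obtain ⟨h1, h2⟩ := hcon
  have e1 : (m - j) * A ≤ (m - j) * (g - 1) :=
    mul_le_mul_of_nonneg_left (by linarith) (by linarith)
  have e2 : (j - 1) * B ≤ (j - 1) * (g - 1) :=
    mul_le_mul_of_nonneg_left (by linarith) (by linarith)
  nlinarith

lemma num2 {m n c N S e j k T : ℤ} (hm : 2 ≤ m) (hc : 3 ≤ c) (hcm : c ≤ 2 * m) (hN : N + c = n)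
    (hj : 2 ≤ j) (hjc : 3 * (j - 1) ≤ c) (hk : k + (j - 1) = c) (hT : T ≤ (j - 1) * j)
    (he : e + k ≤ 2 * T + k * k) (hS : S ≤ e + 2 * j * N) :
    S + 6 * m ≤ 2 * n + 4 * m ^ 2 ∨ S + m * (m + 1) ≤ 2 * m * n := by
  have hjm : j ≤ m := by
    by_contra hcon
    omega
  have h0 : 0 ≤ 2 * m + c + 1 - 4 * j := by
    rcases (by omega : j = 2 ∨ 3 ≤ j) with h | h
    · subst h; omega
    · omega
  have hE := mul_nonneg (sub_nonneg.2 hcm) h0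
  have hS1 : S ≤ (2 * m + 1 - j) * (2 * m - j) + 2 * j * (n - (2 * m + 1 - j)) := by
    have hk' : k = c - (j - 1) := by linarith
    have hN' : N = n - c := by linarith
    subst hk'; subst hN'
    nlinarith
  have := convex_aux (A := 2 * n + 4 * m ^ 2 - 6 * m) (B := 2 * m * n - m * (m + 1))
    (g := (2 * m + 1 - j) * (2 * m - j) + 2 * j * (n - (2 * m + 1 - j)))
    (K := 3 * ((j - 1) * (m - j) * (m - 1))) (m := m) (j := j) (by omega) hjm hm
    (by
      have := mul_nonneg (mul_nonneg (by omega : 0 ≤ j - 1) (by omega : 0 ≤ m - j))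
        (by omega : 0 ≤ m - 1)
      omega)
    (le_of_eq (by ring))
  rcases this with h | h
  · left; linarith
  · right; linarith

lemma num3 {m n c N S e j k T : ℤ} (hm : 2 ≤ m) (hcm : c ≤ 2 * m) (hN : N + c = n)
    (hj : 2 ≤ j) (hjc : 2 * j ≤ c) (hk : k + j = c) (hT : 2 * T ≤ j * c)
    (he : e + k ≤ 2 * T + k * k) (hS : S ≤ e + 2 * j * N) :
    S + 6 * m ≤ 2 * n + 4 * m ^ 2 ∨ S + m * (m + 1) ≤ 2 * m * n := by
  have hjm : j ≤ m := by omega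
  have hE := mul_nonneg (sub_nonneg.2 hcm) (by omega : 0 ≤ 2 * m + c - 1 - 3 * j)
  have hS1 : S ≤ 2 * m * j + (2 * m - j) * (2 * m - j - 1) + 2 * j * (n - 2 * m) := by
    have hk' : k = c - j := by linarith
    have hN' : N = n - c := by linarith
    subst hk'; subst hN'
    nlinarith
  have := convex_aux (A := 2 * n + 4 * m ^ 2 - 8 * m + 2) (B := 2 * m * n - m * (m + 1))
    (g := 2 * m * j + (2 * m - j) * (2 * m - j - 1) + 2 * j * (n - 2 * m))
    (K := ((j - 1) * (m - j) * (m - 1))) (m := m) (j := j) (by omega) hjm hm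
    (mul_nonneg (mul_nonneg (by omega : 0 ≤ j - 1) (by omega : 0 ≤ m - j))
        (by omega : 0 ≤ m - 1))
    (le_of_eq (by ring))
  rcases this with h | h
  · left; linarith
  · right; linarith

section
variable {V : Type*} [Fintype V] [DecidableEq V] (G : SimpleGraph V) [DecidableRel G.Adj]

/-- number of neighbours of `v` inside `S` -/
def dg (S : Finset V) (v : V) : ℕ := (S.filter (G.Adj v)).card

lemma ncard_eq_dg (v : V) : (G.neighborSet v).ncard = dg G Finset.univ v := by
  unfold dg
  rw [← Set.ncard_coe_finset]
  congr 1
  ext w; simp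

lemma dg_mono {S T : Finset V} (h : S ⊆ T) (v : V) : dg G S v ≤ dg G T v :=
  Finset.card_le_card (Finset.filter_subset_filter _ h)

lemma dg_union {S T : Finset V} (h : Disjoint S T) (v : V) :
    dg G (S ∪ T) v = dg G S v + dg G T v := by
  unfold dg
  rw [Finset.filter_union, Finset.card_union_of_disjoint]
  exact Finset.disjoint_filter_filter h

lemma dg_comm (S T : Finset V) : ∑ v ∈ S, dg G T v = ∑ v ∈ T, dg G S v := by
  unfold dg
  simp_rw [Finset.card_filter]
  rw [Finset.sum_comm]
  simp_rw [G.adj_comm]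

lemma cnt1 (C : Finset V) (j : ℕ) (hj : ∀ x, x ∉ C → dg G Finset.univ x ≤ j) :
    ∑ v, dg G Finset.univ v ≤ ∑ v ∈ C, dg G C v + 2 * j * Cᶜ.card := by
  have hU : C ∪ Cᶜ = Finset.univ := Finset.union_compl C
  have hD : Disjoint C Cᶜ := disjoint_compl_right
  have h1 : ∑ v, dg G Finset.univ v = ∑ v ∈ C, dg G Finset.univ v + ∑ v ∈ Cᶜ, dg G Finset.univ v :=
    (Finset.sum_add_sum_compl C _).symm
  have h2 : ∑ v ∈ C, dg G Finset.univ v = ∑ v ∈ C, dg G C v + ∑ v ∈ C, dg G Cᶜ v := by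
    rw [← Finset.sum_add_distrib]
    refine Finset.sum_congr rfl fun v _ => ?_
    rw [← dg_union G hD, hU]
  have h3 : ∑ v ∈ C, dg G Cᶜ v ≤ ∑ v ∈ Cᶜ, dg G Finset.univ v := by
    rw [dg_comm]
    exact Finset.sum_le_sum fun v _ => dg_mono G (Finset.subset_univ _) v
  have h4 : ∑ v ∈ Cᶜ, dg G Finset.univ v ≤ Cᶜ.card * j := by
    rw [← smul_eq_mul]
    exact Finset.sum_le_card_nsmul _ _ _ fun x hx => hj x (by simpa using hx)
  nlinarith

lemma cnt2 {U C : Finset V} (h : U ⊆ C) :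
    ∑ v ∈ C, dg G C v + (C \ U).card ≤ 2 * ∑ v ∈ U, dg G C v + (C \ U).card * (C \ U).card := by
  have h1 : ∑ v ∈ C, dg G C v = ∑ v ∈ C \ U, dg G C v + ∑ v ∈ U, dg G C v :=
    (Finset.sum_sdiff h).symm
  have hD : Disjoint U (C \ U) := Finset.disjoint_sdiff
  have hU : U ∪ (C \ U) = C := Finset.union_sdiff_of_subset h
  have h2 : ∑ v ∈ C \ U, dg G C v = ∑ v ∈ C \ U, dg G U v + ∑ v ∈ C \ U, dg G (C \ U) v := by
    rw [← Finset.sum_add_distrib]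
    refine Finset.sum_congr rfl fun v _ => ?_
    rw [← dg_union G hD, hU]
  have h3 : ∑ v ∈ C \ U, dg G U v ≤ ∑ v ∈ U, dg G C v := by
    rw [dg_comm]
    exact Finset.sum_le_sum fun v _ => dg_mono G Finset.sdiff_subset v
  have h4 : ∑ v ∈ C \ U, dg G (C \ U) v + (C \ U).card ≤ (C \ U).card * (C \ U).card := by
    have : ∑ v ∈ C \ U, (dg G (C \ U) v + 1) ≤ (C \ U).card • (C \ U).card := by
      refine Finset.sum_le_card_nsmul _ _ _ fun x hx => ?_
      apply Finset.card_lt_card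
      rw [Finset.filter_ssubset]
      exact ⟨x, hx, G.irrefl⟩
    rw [Finset.sum_add_distrib] at this
    simpa using this
  omega

end

lemma pair_sum {V : Type*} [DecidableEq V] (U : Finset V) (f : V → ℕ) (c : ℕ) (h2 : 2 ≤ U.card)
    (h : ∀ u ∈ U, ∀ w ∈ U, u ≠ w → f u + f w ≤ c) : 2 * ∑ u ∈ U, f u ≤ U.card * c := by
  have h1 : ∀ u ∈ U, ∑ w ∈ U, (f u + f w) ≤ (U.card - 1) * c + 2 * f u := by
    intro u hu
    rw [← Finset.sum_erase_add _ _ hu]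
    have : ∑ w ∈ U.erase u, (f u + f w) ≤ (U.erase u).card • c :=
      Finset.sum_le_card_nsmul _ _ _ fun w hw => by
        rw [Finset.mem_erase] at hw
        exact h u hu w hw.2 (Ne.symm hw.1)
    rw [Finset.card_erase_of_mem hu, smul_eq_mul] at this
    omega
  have h3 := Finset.sum_le_sum h1
  simp only [Finset.sum_add_distrib, Finset.sum_const, smul_eq_mul, ← Finset.mul_sum] at h3
  obtain ⟨k, hk⟩ : ∃ k, U.card = k + 2 := ⟨U.card - 2, by omega⟩
  rw [hk] at h3 ⊢
  have e : k + 2 - 1 = k + 1 := rfl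
  rw [e] at h3
  generalize ∑ u ∈ U, f u = s at *
  by_contra hcon
  push Not at hcon
  have := Nat.mul_lt_mul_of_pos_left hcon (Nat.succ_pos k)
  simp only [Nat.succ_eq_add_one] at this
  nlinarith

lemma main_bound {V : Type*} [Fintype V] [DecidableEq V] {G : SimpleGraph V} {l : List V}
    {m n : ℕ} (hM : MaxC G l) (hm : 2 ≤ m) (hn : Fintype.card V = n) (hn2 : 2 * m + 1 ≤ n)
    (hlm : l.length ≤ 2 * m) :
    (∑ v, (G.neighborSet v).ncard) + 6 * m ≤ 2 * n + 4 * m ^ 2 ∨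
      (∑ v, (G.neighborSet v).ncard) + m * (m + 1) ≤ 2 * m * n := by
  classical
  set C := l.toFinset with hC
  have hcard : C.card = l.length := List.toFinset_card_of_nodup hM.1.2.1
  have hc3 := hM.1.1
  have hmC : ∀ {z}, z ∈ C ↔ z ∈ l := fun {z} => List.mem_toFinset
  have hcomp : Cᶜ.card + l.length = n := by
    rw [← hcard, ← hn, Finset.card_compl_add_card]
  simp_rw [ncard_eq_dg]
  obtain ⟨x, hxC, hmax⟩ := Finset.exists_max_image Cᶜ (dg G Finset.univ)
    (by rw [← Finset.card_pos]; omega)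
  have hx : x ∉ l := by simpa [hC] using hxC
  have hj : ∀ z, z ∉ C → dg G Finset.univ z ≤ dg G Finset.univ x :=
    fun z hz => hmax z (by simpa using hz)
  obtain ⟨j, hjd⟩ : ∃ j, j = dg G Finset.univ x := ⟨_, rfl⟩
  rw [← hjd] at hj
  by_cases hj1 : j ≤ 1
  · left
    have e1 := cnt1 G C 1 (fun z hz => (hj z hz).trans hj1)
    have e2 := cnt2 G (Finset.empty_subset C)
    simp only [Finset.sdiff_empty, Finset.sum_empty, hcard] at e2
    have := num1 (m := m) (n := n) (c := l.length) (N := Cᶜ.card)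
      (S := (∑ v, dg G Finset.univ v : ℕ)) (e := (∑ v ∈ C, dg G C v : ℕ)) (by exact_mod_cast hc3)
      (by exact_mod_cast hlm) (by exact_mod_cast hcomp) (by exact_mod_cast (by omega)) (by exact_mod_cast e1)
    exact_mod_cast this
  push Not at hj1
  have e1 := cnt1 G C j hj
  set σ := l.formPerm with hσ
  have hσm : ∀ {q}, q ∈ C → σ q ∈ C := fun hq => hmC.2 (hM.1.sig_mem (hmC.1 hq))
  set Q := C.filter (G.Adj x) with hQ
  have hQC : Q ⊆ C := Finset.filter_subset _ _
  set U := Q.image σ with hU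
  have hUC : U ⊆ C := by
    intro u hu
    obtain ⟨q, hq, rfl⟩ := Finset.mem_image.1 hu
    exact hσm (hQC hq)
  have hUQ : U.card = Q.card := Finset.card_image_of_injective _ σ.injective
  have hQU : Disjoint Q U := by
    rw [Finset.disjoint_left]
    intro z hz hzU
    obtain ⟨q, hq, rfl⟩ := Finset.mem_image.1 hzU
    have hq' := Finset.mem_filter.1 hq
    exact F1 hM (hmC.1 hq'.1) hx hq'.2 (Finset.mem_filter.1 hz).2
  have e2 := cnt2 G hUC
  have e3 : (C \ U).card + U.card = l.length := by
    rw [← hcard]; exact Finset.card_sdiff_add_card_eq_card hUC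
  by_cases hy : ∃ y, y ∉ l ∧ G.Adj x y
  · obtain ⟨y, hy, hxy⟩ := hy
    have hQj : Q.card + 1 = j := by
      have : Finset.univ.filter (G.Adj x) = insert y Q := by
        ext z
        simp only [Finset.mem_filter, Finset.mem_univ, true_and, Finset.mem_insert, hQ]
        constructor
        · intro hz
          by_cases hzl : z ∈ l
          · right; exact ⟨hmC.2 hzl, hz⟩
          · left; exact F6 hM hx hzl hy hz hxy
        · rintro (rfl | h)
          · exact hxy
          · exact h.2
      rw [hjd, dg, this, Finset.card_insert_of_notMem]
      intro h
      exact hy (hmC.1 (hQC h))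
    have hW : Disjoint Q (U.image σ) := by
      rw [Finset.disjoint_left]
      intro z hz hzU
      obtain ⟨u, hu, rfl⟩ := Finset.mem_image.1 hzU
      obtain ⟨q, hq, rfl⟩ := Finset.mem_image.1 hu
      have hq' := Finset.mem_filter.1 hq
      exact F6a hM hx hy hxy (hmC.1 hq'.1) hq'.2 (Finset.mem_filter.1 hz).2
    have hUW : Disjoint U (U.image σ) := by
      rw [hU]
      exact (Finset.disjoint_image σ.injective).2 hQU
    have h3 : 3 * Q.card ≤ l.length := by
      have hsub : (Q ∪ U) ∪ U.image σ ⊆ C := by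
        refine Finset.union_subset (Finset.union_subset hQC hUC) ?_
        intro u hu
        obtain ⟨q, hq, rfl⟩ := Finset.mem_image.1 hu
        exact hσm (hUC hq)
      have := Finset.card_le_card hsub
      rw [Finset.card_union_of_disjoint (Finset.disjoint_union_left.2 ⟨hW, hUW⟩),
        Finset.card_union_of_disjoint hQU, Finset.card_image_of_injective U σ.injective, hUQ,
        hcard] at this
      omega
    have hT : ∑ v ∈ U, dg G C v ≤ Q.card * j := by
      rw [← hUQ, ← smul_eq_mul]
      refine Finset.sum_le_card_nsmul _ _ _ fun u hu => ?_
      obtain ⟨q, hq, rfl⟩ := Finset.mem_image.1 hu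
      have hq' := Finset.mem_filter.1 hq
      have := F7 hM hx hy hxy (hmC.1 hq'.1) hq'.2
      rw [ncard_eq_dg, ncard_eq_dg, ← hjd] at this
      exact (dg_mono G (Finset.subset_univ _) _).trans this
    rw [hUQ] at e3
    have hQz : (Q.card : ℤ) = j - 1 := by omega
    have := num2 (m := m) (n := n) (c := l.length) (N := Cᶜ.card) (j := j) (k := (C \ U).card)
      (T := (∑ v ∈ U, dg G C v : ℕ))
      (S := (∑ v, dg G Finset.univ v : ℕ)) (e := (∑ v ∈ C, dg G C v : ℕ)) (by exact_mod_cast hm)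
      (by exact_mod_cast hc3)
      (by exact_mod_cast hlm) (by exact_mod_cast hcomp) (by exact_mod_cast hj1) (by omega) (by omega)
      (by rw [← hQz]; exact_mod_cast hT) (by exact_mod_cast e2) (by exact_mod_cast e1)
    exact_mod_cast this
  · push Not at hy
    have hQj : Q.card = j := by
      have : Finset.univ.filter (G.Adj x) = Q := by
        ext z
        simp only [Finset.mem_filter, Finset.mem_univ, true_and, hQ]
        constructor
        · intro hz
          by_cases hzl : z ∈ l
          · exact ⟨hmC.2 hzl, hz⟩
          · exact absurd hz (hy z hzl)
        · exact fun h => h.2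
      rw [hjd, dg, this]
    have h2 : 2 * Q.card ≤ l.length := by
      have := Finset.card_le_card (Finset.union_subset hQC hUC)
      rw [Finset.card_union_of_disjoint hQU, hUQ, hcard] at this
      omega
    have hT : 2 * ∑ v ∈ U, dg G C v ≤ U.card * l.length := by
      refine pair_sum U _ _ (by omega) ?_
      intro u hu w hw huw
      obtain ⟨q, hq, rfl⟩ := Finset.mem_image.1 hu
      obtain ⟨r, hr, rfl⟩ := Finset.mem_image.1 hw
      have hq' := Finset.mem_filter.1 hq
      have hr' := Finset.mem_filter.1 hr
      exact cross_main hM hx (hmC.1 hq'.1) (hmC.1 hr'.1) (by rintro rfl; exact huw rfl) hq'.2 hr'.2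
    rw [hUQ, hQj] at hT e3
    rw [hQj] at h2
    have := num3 (m := m) (n := n) (c := l.length) (N := Cᶜ.card) (j := j) (k := (C \ U).card)
      (T := (∑ v ∈ U, dg G C v : ℕ))
      (S := (∑ v, dg G Finset.univ v : ℕ)) (e := (∑ v ∈ C, dg G C v : ℕ)) (by exact_mod_cast hm)
      (by exact_mod_cast hlm) (by exact_mod_cast hcomp) (by exact_mod_cast hj1) (by omega) (by omega)
      (by exact_mod_cast hT) (by exact_mod_cast e2) (by exact_mod_cast e1)
    exact_mod_cast this

end SC

namespace SC

open List

lemma exists_maxC {V : Type*} [Fintype V] {G : SimpleGraph V} {l0 : List V} (h0 : Cyc G l0) :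
    ∃ H l, SameDeg G H ∧ MaxC H l := by
  classical
  let P : ℕ → Prop := fun k => ∃ H l, SameDeg G H ∧ Cyc H l ∧ l.length = k
  have hb : ∀ k, P k → k ≤ Fintype.card V := by
    rintro k ⟨H, l, -, hc, rfl⟩
    rw [← List.toFinset_card_of_nodup hc.2.1]
    exact Finset.card_le_univ _
  have hP0 : P l0.length := ⟨G, l0, SameDeg.refl G, h0, rfl⟩
  obtain ⟨H, l, hd, hc, hl⟩ := Nat.findGreatest_spec (hb _ hP0) hP0
  refine ⟨H, l, hd, hc, fun K l' hK hc' => ?_⟩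
  have hP' : P l'.length := ⟨K, l', hd.trans hK, hc', rfl⟩
  rw [hl]
  exact Nat.le_findGreatest (hb _ hP') hP'

lemma exists_cyc {V : Type*} [Fintype V] [Nonempty V] {G : SimpleGraph V}
    (h : 2 * Fintype.card V ≤ ∑ v, (G.neighborSet v).ncard) : ∃ l, Cyc G l := by
  classical
  by_contra hcon
  have hac : G.IsAcyclic := by
    intro v c hc
    obtain ⟨l, hl, -⟩ := Cyc.ofWalk hc
    exact hcon ⟨l, hl⟩
  obtain ⟨F, hF, -, hT⟩ := SimpleGraph.connected_top.exists_isTree_le_of_le_of_isAcyclic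
    (le_top : G ≤ ⊤) hac
  have h1 := hT.card_edgeFinset
  have h2 : G.edgeFinset.card ≤ F.edgeFinset.card :=
    Finset.card_le_card (SimpleGraph.edgeFinset_subset_edgeFinset.2 hF)
  have h3 := G.sum_degrees_eq_twice_card_edges
  have h4 : ∑ v, (G.neighborSet v).ncard = ∑ v, G.degree v := by
    refine Finset.sum_congr rfl fun v _ => ?_
    rw [ncard_eq_dg, dg, ← SimpleGraph.card_neighborFinset_eq_degree, SimpleGraph.neighborFinset_eq_filter]
  omega

lemma upper {m n : ℕ} (hm : 2 ≤ m) (hn : 2 * m + 1 ≤ n) (d : Fin n → ℕ) (hg : Graphic d)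
    (hS : max (2 * n + 4 * m ^ 2 - 6 * m) (m * (2 * n - m - 1)) + 2 ≤ ∑ i, d i) :
    PotC (2 * m + 1) d := by
  obtain ⟨G, hG⟩ := hg
  have : Nonempty (Fin n) := ⟨⟨0, by omega⟩⟩
  have hS' : ∑ i, d i = ∑ v, (G.neighborSet v).ncard := Finset.sum_congr rfl fun v _ => (hG v).symm
  rw [hS'] at hS
  have hA := le_trans (Nat.add_le_add_right (le_max_left _ _) 2) hS
  have hB := le_trans (Nat.add_le_add_right (le_max_right _ _) 2) hS
  have h6 : 2 * m ≤ m ^ 2 := by nlinarith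
  obtain ⟨l0, hl0⟩ := exists_cyc (G := G) (by rw [Fintype.card_fin]; omega)
  obtain ⟨H, l, hd, hM⟩ := exists_maxC hl0
  have hsum : ∑ v, (H.neighborSet v).ncard = ∑ v, (G.neighborSet v).ncard :=
    Finset.sum_congr rfl fun v _ => hd v
  have hlen : 2 * m + 1 ≤ l.length := by
    by_contra hlt
    rcases main_bound hM hm (Fintype.card_fin n) hn (by omega) with h | h
    · rw [hsum] at h
      omega
    · rw [hsum] at h
      obtain ⟨k, rfl⟩ : ∃ k, n = m + 1 + k := ⟨n - (m + 1), by omega⟩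
      have e : 2 * (m + 1 + k) - m - 1 = m + 1 + 2 * k := by omega
      rw [e] at hB
      nlinarith
  have hdeg : ∃ w, 3 ≤ (G.neighborSet w).ncard := by
    by_contra! hcon
    have : ∑ v, (G.neighborSet v).ncard ≤ (Finset.univ : Finset (Fin n)).card • 2 :=
      Finset.sum_le_card_nsmul _ _ _ fun v _ => by have := hcon v; omega
    simp at this
    omega
  obtain ⟨K, l', hK, hc, hl'⟩ := shorten_to hdeg (2 * m + 1) (by omega) (l.length - (2 * m + 1)) H l
    hd hM.1 (by omega)
  refine ⟨K, fun v => (hK v).trans (hG v), ?_⟩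
  rw [← hl']
  exact hc.toWalk

lemma ncard_lt {n k : ℕ} (h : k ≤ n) : {j : Fin n | (j : ℕ) < k}.ncard = k := by
  have : {j : Fin n | (j : ℕ) < k} = Set.range (Fin.castLE h) := by
    ext j
    simp only [Set.mem_ofPred_eq, Set.mem_range]
    constructor
    · intro hj; exact ⟨⟨j, hj⟩, rfl⟩
    · rintro ⟨i, rfl⟩; simp
  rw [this, Set.ncard_range_of_injective (Fin.castLE_injective h)]
  simp

lemma ncard_ne {n : ℕ} (i : Fin n) : {j : Fin n | j ≠ i}.ncard = n - 1 := by
  have : {j : Fin n | j ≠ i} = Set.univ \ {i} := by ext j; simp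
  rw [this, Set.ncard_sdiff_singleton_of_mem (Set.mem_univ _), Set.ncard_univ]
  simp

lemma Cyc.deg {V : Type*} [Finite V] {G : SimpleGraph V} {l : List V} (hc : Cyc G l) {v : V}
    (hv : v ∈ l) : 2 ≤ (G.neighborSet v).ncard := by
  obtain ⟨h, s, hr, hs⟩ := rot_last hv hc.1
  obtain ⟨t, b, rfl⟩ := (List.eq_nil_or_concat s).resolve_left hs
  obtain ⟨-, hn, hch, hvh⟩ := cyc_iff.1 (hc.rot hr)
  have e : h :: (t.concat b ++ [v]) = (h :: t) ++ b :: v :: [] := by simp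
  rw [e] at hn hch
  rw [isChain_append_cons_cons] at hch
  have hbh : b ≠ h := by
    rintro rfl
    simp at hn
  have hsub : {b, h} ⊆ G.neighborSet v := by
    rintro z (rfl | rfl)
    · exact hch.2.1.symm
    · exact hvh
  have := Set.ncard_le_ncard hsub
  rwa [Set.ncard_pair hbh] at this

lemma lowerA {m n : ℕ} (hm : 2 ≤ m) (hn : 2 * m + 1 ≤ n) :
    ∃ d : Fin n → ℕ, Antitone d ∧ Graphic d ∧ ∑ i, d i = 2 * n + 4 * m ^ 2 - 6 * m ∧
      ¬ PotC (2 * m + 1) d := by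
  classical
  refine ⟨fun i => if (i : ℕ) = 0 then n - 1 else if (i : ℕ) < 2 * m then 2 * m - 1 else 1,
    ?_, ?_, ?_, ?_⟩
  · intro i j hij
    have : (i : ℕ) ≤ j := hij
    dsimp only
    split_ifs <;> omega
  · refine ⟨⟨fun i j => i ≠ j ∧ ((i : ℕ) = 0 ∨ (j : ℕ) = 0 ∨ ((i : ℕ) < 2 * m ∧ (j : ℕ) < 2 * m)),
      ⟨?_⟩, ⟨?_⟩⟩, ?_⟩
    · intro i j h; grind
    · intro i h; exact h.1 rfl
    · intro i
      dsimp only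
      split_ifs with h1 h2
      · rw [← ncard_ne i]
        congr 1; ext j
        simp only [SimpleGraph.mem_neighborSet, Set.mem_ofPred_eq]; grind
      · have := Set.ncard_sdiff_singleton_of_mem (s := {j : Fin n | (j : ℕ) < 2 * m}) (a := i) h2
        rw [ncard_lt (by omega)] at this
        rw [← this]
        congr 1; ext j
        simp only [SimpleGraph.mem_neighborSet, Set.mem_ofPred_eq, Set.mem_sdiff,
          Set.mem_singleton_iff]
        have := Fin.ext_iff (a := i) (b := j)
        grind
      · have : (1 : ℕ) = ({(⟨0, by omega⟩ : Fin n)} : Set (Fin n)).ncard := by simp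
        rw [this]
        congr 1; ext j
        simp only [SimpleGraph.mem_neighborSet, Set.mem_singleton_iff, Fin.ext_iff]
        grind
  · rw [Fin.sum_univ_eq_sum_range (fun i => if i = 0 then n - 1 else if i < 2 * m then 2 * m - 1 else 1) n]
    obtain ⟨p, rfl⟩ : ∃ p, m = p + 2 := ⟨m - 2, by omega⟩
    obtain ⟨k, rfl⟩ : ∃ k, n = (2 * p + 3) + 1 + k := ⟨n - (2 * (p + 2)), by omega⟩
    rw [Finset.sum_range_add, Finset.sum_range_succ']
    have s1 : ∑ i ∈ Finset.range (2 * p + 3), (if i + 1 = 0 then 2 * p + 3 + 1 + k - 1 else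
        if i + 1 < 2 * (p + 2) then 2 * (p + 2) - 1 else 1) = (2 * p + 3) * (2 * p + 3) := by
      rw [Finset.sum_congr rfl (g := fun _ => 2 * p + 3)]
      · simp
      · intro i hi
        have := Finset.mem_range.1 hi
        rw [if_neg (by omega), if_pos (by omega)]; omega
    have s2 : ∑ i ∈ Finset.range k, (if 2 * p + 3 + 1 + i = 0 then 2 * p + 3 + 1 + k - 1 else
        if 2 * p + 3 + 1 + i < 2 * (p + 2) then 2 * (p + 2) - 1 else 1) = k := by
      rw [Finset.sum_congr rfl (g := fun _ => 1)]
      · simp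
      · intro i hi
        rw [if_neg (by omega), if_neg (by omega)]
    rw [s1, s2]
    simp only [if_true]
    have e : 2 * (2 * p + 3 + 1 + k) + 4 * (p + 2) ^ 2 = 6 * (p + 2) +
      ((2 * p + 3) * (2 * p + 3) + (2 * p + 3 + k) + k) := by ring
    rw [e]
    omega
  · rintro ⟨G, hG, v, c, hc, hlen⟩
    obtain ⟨l, hl, hl2⟩ := Cyc.ofWalk hc
    have hsub : ∀ v ∈ l.toFinset, (v : ℕ) ∈ Finset.range (2 * m) := by
      intro v hv
      have h2 := hl.deg (List.mem_toFinset.1 hv)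
      rw [hG v] at h2
      dsimp only at h2
      rw [Finset.mem_range]
      by_contra hcon
      rw [if_neg (by omega), if_neg (by omega)] at h2
      omega
    have := Finset.card_le_card_of_injOn (fun v : Fin n => (v : ℕ)) hsub
      (fun a _ b _ h => Fin.ext h)
    rw [List.toFinset_card_of_nodup hl.2.1, Finset.card_range] at this
    omega

lemma lowerB {m n : ℕ} (hm : 2 ≤ m) (hn : 2 * m + 1 ≤ n) :
    ∃ d : Fin n → ℕ, Antitone d ∧ Graphic d ∧ ∑ i, d i = m * (2 * n - m - 1) ∧
      ¬ PotC (2 * m + 1) d := by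
  classical
  refine ⟨fun i => if (i : ℕ) < m then n - 1 else m, ?_, ?_, ?_, ?_⟩
  · intro i j hij
    have : (i : ℕ) ≤ j := hij
    dsimp only
    split_ifs <;> omega
  · refine ⟨⟨fun i j => i ≠ j ∧ ((i : ℕ) < m ∨ (j : ℕ) < m), ⟨?_⟩, ⟨?_⟩⟩, ?_⟩
    · intro i j h; grind
    · intro i h; exact h.1 rfl
    · intro i
      dsimp only
      split_ifs with h1
      · rw [← ncard_ne i]
        congr 1; ext j
        simp only [SimpleGraph.mem_neighborSet, Set.mem_ofPred_eq]; grind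
      · have := ncard_lt (n := n) (k := m) (by omega)
        refine Eq.trans ?_ this
        congr 1; ext j
        simp only [SimpleGraph.mem_neighborSet, Set.mem_ofPred_eq]
        have := Fin.ext_iff (a := i) (b := j)
        grind
  · rw [Fin.sum_univ_eq_sum_range (fun i => if i < m then n - 1 else m) n]
    obtain ⟨k, rfl⟩ : ∃ k, n = m + (k + 1) := ⟨n - m - 1, by omega⟩
    rw [Finset.sum_range_add]
    rw [Finset.sum_congr rfl (g := fun _ => m + k), Finset.sum_congr (s₁ := Finset.range (k + 1)) rfl (g := fun _ => m)]
    · simp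
      have : 2 * (m + (k + 1)) - m - 1 = m + 2 * k + 1 := by omega
      rw [this]; ring
    · intro i _
      rw [if_neg (by omega)]
    · intro i hi
      have := Finset.mem_range.1 hi
      rw [if_pos this]; omega
  · rintro ⟨G, hG, v, c, hc, hlen⟩
    obtain ⟨l, hl, hl2⟩ := Cyc.ofWalk hc
    have hfull : ∀ i j : Fin n, (i : ℕ) < m → j ≠ i → G.Adj i j := by
      intro i j hi hj
      have h1 : G.neighborSet i ⊆ {j : Fin n | j ≠ i} := fun z hz => (SimpleGraph.Adj.ne hz).symm
      have h2 := Set.eq_of_subset_of_ncard_le h1 (by rw [ncard_ne, hG i]; simp [hi])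
      have : j ∈ G.neighborSet i := by rw [h2]; exact hj
      exact this
    have hind : ∀ i j : Fin n, m ≤ (i : ℕ) → G.Adj i j → (j : ℕ) < m := by
      intro i j hi hij
      have h1 : {j : Fin n | (j : ℕ) < m} ⊆ G.neighborSet i := by
        intro z hz
        have hz' : (z : ℕ) < m := hz
        exact (hfull z i hz' (by rintro rfl; omega)).symm
      have h2 := Set.eq_of_subset_of_ncard_le h1 (by
        rw [ncard_lt (by omega), hG i]; dsimp only; rw [if_neg (by omega)])
      have : j ∈ {j : Fin n | (j : ℕ) < m} := by rw [h2]; exact hij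
      exact this
    have h1 : (l.toFinset.filter (fun v : Fin n => (v : ℕ) < m)).card ≤ m := by
      have := Finset.card_le_card_of_injOn (s := l.toFinset.filter (fun v : Fin n => (v : ℕ) < m))
        (t := Finset.range m) (fun v : Fin n => (v : ℕ))
        (fun v hv => by simpa using (Finset.mem_filter.1 hv).2) (fun a _ b _ h => Fin.ext h)
      simpa using this
    have h2 : (l.toFinset.filter (fun v : Fin n => ¬ (v : ℕ) < m)).card ≤
        (l.toFinset.filter (fun v : Fin n => (v : ℕ) < m)).card := by
      refine Finset.card_le_card_of_injOn l.formPerm ?_ (l.formPerm.injective.injOn)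
      intro v hv
      have hv' := Finset.mem_filter.1 hv
      have hvl := List.mem_toFinset.1 hv'.1
      refine Finset.mem_coe.2 (Finset.mem_filter.2 ⟨List.mem_toFinset.2 (hl.sig_mem hvl), ?_⟩)
      exact hind v _ (by have := hv'.2; omega) (hl.sig_adj hvl)
    have h3 := Finset.card_filter_add_card_filter_not (s := l.toFinset) (fun v : Fin n => (v : ℕ) < m)
    rw [List.toFinset_card_of_nodup hl.2.1] at h3
    omega

end SC

/-- **Theorem 1.4, odd case.** For `m ≥ 2` and `n ≥ 2m+1`,
`σ(C_{2m+1}, n) = max{2n + 4m² − 6m, m(2n − m − 1)} + 2`: every graphic sequence of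
length `n` with sum at least this value is potentially `C_{2m+1}`-graphic, and some
graphic sequence of length `n` with sum `max{2n + 4m² − 6m, m(2n − m − 1)}` is not
potentially `C_{2m+1}`-graphic. -/
theorem sigma_C_odd (m n : ℕ) (hm : 2 ≤ m) (hn : 2 * m + 1 ≤ n) :
    (∀ d : Fin n → ℕ, Antitone d → Graphic d →
      max (2 * n + 4 * m ^ 2 - 6 * m) (m * (2 * n - m - 1)) + 2 ≤ ∑ i, d i →
      PotC (2 * m + 1) d) ∧
    (∃ d : Fin n → ℕ, Antitone d ∧ Graphic d ∧
      ∑ i, d i = max (2 * n + 4 * m ^ 2 - 6 * m) (m * (2 * n - m - 1)) ∧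
      ¬ PotC (2 * m + 1) d) := by
  refine ⟨fun d _ hg hS => SC.upper hm hn d hg hS, ?_⟩
  rcases le_total (2 * n + 4 * m ^ 2 - 6 * m) (m * (2 * n - m - 1)) with h | h
  · rw [max_eq_right h]; exact SC.lowerB hm hn
  · rw [max_eq_left h]; exact SC.lowerA hm hn
end

section
/- Let m ≥ 2 and n ≥ 2m+2. Then σ(C_{2m+2}, n) = max{2n + 4m² − 2m − 2, m(2n − m − 1) + 2} + 2; that is, every graphic sequence π of length n with σ(π) ≥ max{2n + 4m² − 2m − 2, m(2n − m − 1) + 2} + 2 is potentially C_{2m+2}-graphic, and there exists a graphic sequence π of length n with σ(π) = max{2n + 4m² − 2m − 2, m(2n − m − 1) + 2} that is not potentially C_{2m+2}-graphic. -/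
section AllHelpers
set_option linter.unusedSectionVars false
set_option linter.unusedSimpArgs false
open Finset

section Helpers
open Classical

variable {V : Type*} [Fintype V]

noncomputable def nb (G : SimpleGraph V) (v : V) : Finset V := univ.filter (fun w => G.Adj v w)

theorem mem_nb {G : SimpleGraph V} {v w : V} : w ∈ nb G v ↔ G.Adj v w := by simp [nb]

def Rlz (G : SimpleGraph V) (d : V → ℕ) : Prop := ∀ v, (nb G v).card = d v

/-- The two-switch: `ua, vb` are replaced by `uv, ab`. -/
def swGraph (G : SimpleGraph V) (u a v b : V) (huv : u ≠ v) (hab : a ≠ b) : SimpleGraph V where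
  Adj x y := (G.Adj x y ∧ s(x, y) ≠ s(u, a) ∧ s(x, y) ≠ s(v, b)) ∨ s(x, y) = s(u, v) ∨ s(x, y) = s(a, b)
  symm := ⟨by
    intro x y h
    rw [Sym2.eq_swap (a := y) (b := x)]
    rcases h with ⟨h, h2⟩ | h
    · exact Or.inl ⟨h.symm, h2⟩
    · exact Or.inr h⟩
  loopless := ⟨by
    intro x h
    rcases h with ⟨h, h2⟩ | h | h
    · exact G.loopless.irrefl x h
    · simp only [Sym2.eq_iff] at h
      apply huv; rcases h with h | h <;> rw [← h.1, ← h.2]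
    · simp only [Sym2.eq_iff] at h
      apply hab; rcases h with h | h <;> rw [← h.1, ← h.2]⟩

theorem swGraph_adj {G : SimpleGraph V} {u a v b : V} {huv : u ≠ v} {hab : a ≠ b} {x y : V} :
    (swGraph G u a v b huv hab).Adj x y ↔
     (G.Adj x y ∧ s(x, y) ≠ s(u, a) ∧ s(x, y) ≠ s(v, b)) ∨ s(x, y) = s(u, v) ∨ s(x, y) = s(a, b) :=
  Iff.rfl

theorem card_swap {s t : Finset V} {a v : V} (ha : a ∈ s) (hv : v ∉ s)
    (h : ∀ x, x ∈ t ↔ (x ∈ s ∧ x ≠ a) ∨ x = v) : t.card = s.card := by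
  have : t = insert v (s.erase a) := by
    ext x; rw [h]; simp only [mem_insert, mem_erase]; tauto
  rw [this, card_insert_of_notMem (by simp [hv]), card_erase_of_mem ha]
  have := card_pos.mpr ⟨a, ha⟩
  omega

theorem sw_real {G : SimpleGraph V} {d : V → ℕ} (hG : Rlz G d) {u a v b : V}
    (huv : u ≠ v) (hab : a ≠ b) (hua : G.Adj u a) (hvb : G.Adj v b) (nuv : ¬ G.Adj u v)
    (nab : ¬ G.Adj a b) : Rlz (swGraph G u a v b huv hab) d := by
  have hub : u ≠ b := by rintro rfl; exact nuv hvb.symm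
  have hav : a ≠ v := by rintro rfl; exact nuv hua
  have hua' := hua.ne
  have hvb' := hvb.ne
  have nvu : ¬ G.Adj v u := fun h => nuv h.symm
  have nba : ¬ G.Adj b a := fun h => nab h.symm
  intro x
  rw [← hG x]
  by_cases h1 : x = u
  · subst h1
    refine card_swap (a := a) (v := v) (mem_nb.2 hua) (by rwa [mem_nb]) ?_
    intro y; rw [mem_nb, mem_nb, swGraph_adj]; simp only [ne_eq, Sym2.eq_iff]
    grind
  by_cases h2 : x = a
  · subst h2
    refine card_swap (a := u) (v := b) (mem_nb.2 hua.symm) (by rwa [mem_nb]) ?_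
    intro y; rw [mem_nb, mem_nb, swGraph_adj]; simp only [ne_eq, Sym2.eq_iff]
    grind
  by_cases h3 : x = v
  · subst h3
    refine card_swap (a := b) (v := u) (mem_nb.2 hvb) (by rwa [mem_nb]) ?_
    intro y; rw [mem_nb, mem_nb, swGraph_adj]; simp only [ne_eq, Sym2.eq_iff]
    grind
  by_cases h4 : x = b
  · subst h4
    refine card_swap (a := v) (v := a) (mem_nb.2 hvb.symm) (by rwa [mem_nb]) ?_
    intro y; rw [mem_nb, mem_nb, swGraph_adj]; simp only [ne_eq, Sym2.eq_iff]
    grind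
  congr 1
  ext y; rw [mem_nb, mem_nb, swGraph_adj]; simp only [ne_eq, Sym2.eq_iff]
  grind

def Lay (k : ℕ) (T : Finset V) (p : ℕ → V) : Prop :=
  (∀ i < k, ∀ j < k, p i = p j → i = j) ∧ (∀ v, v ∈ T ↔ ∃ i < k, p i = v)

noncomputable def ind (P : Prop) : ℕ := if P then 1 else 0

noncomputable def cnt (G : SimpleGraph V) (k : ℕ) (p : ℕ → V) : ℕ :=
  ∑ i ∈ range (k - 1), ind (G.Adj (p i) (p (i + 1)))

def rv (i : ℕ) (p : ℕ → V) : ℕ → V := fun j => if j ≤ i then p (i - j) else p j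

theorem rv_le {i j : ℕ} {p : ℕ → V} (h : j ≤ i) : rv i p j = p (i - j) := by simp [rv, h]
theorem rv_gt {i j : ℕ} {p : ℕ → V} (h : i < j) : rv i p j = p j := by
  simp [rv, not_le.2 h]

theorem rv_ord {k i : ℕ} {T : Finset V} {p : ℕ → V} (hi : i < k) (h : Lay k T p) :
    Lay k T (rv i p) := by
  constructor
  · intro a ha b hb hab
    unfold rv at hab
    split_ifs at hab <;> have := h.1 _ (by omega) _ (by omega) hab <;> omega
  · intro v
    rw [h.2]
    constructor
    · rintro ⟨j, hj, rfl⟩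
      by_cases hji : j ≤ i
      · exact ⟨i - j, by omega, by rw [rv_le (by omega)]; congr 1; omega⟩
      · exact ⟨j, hj, rv_gt (by omega)⟩
    · rintro ⟨j, hj, rfl⟩
      by_cases hji : j ≤ i
      · exact ⟨i - j, by omega, by rw [rv_le (by omega)]⟩
      · exact ⟨j, hj, (rv_gt (by omega)).symm⟩

theorem rv_sum (G : SimpleGraph V) (i : ℕ) (p : ℕ → V) :
    ∑ j ∈ range i, ind (G.Adj (rv i p j) (rv i p (j + 1))) =
    ∑ j ∈ range i, ind (G.Adj (p j) (p (j + 1))) := by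
  rw [← sum_range_reflect (fun j => ind (G.Adj (p j) (p (j + 1))))]
  apply sum_congr rfl
  intro j hj
  rw [mem_range] at hj
  rw [rv_le (by omega), rv_le (by omega), SimpleGraph.adj_comm]
  have e1 : i - (j + 1) = i - 1 - j := by omega
  have e2 : i - j = i - 1 - j + 1 := by omega
  rw [e1, e2]

theorem cnt_rv_full (G : SimpleGraph V) (k : ℕ) (p : ℕ → V) :
    cnt G k (rv (k - 1) p) = cnt G k p := rv_sum G (k - 1) p

theorem cnt_rv (G : SimpleGraph V) {k i : ℕ} (p : ℕ → V) (hi : i + 1 < k) :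
    cnt G k (rv i p) + ind (G.Adj (p i) (p (i + 1))) = cnt G k p + ind (G.Adj (p 0) (p (i + 1))) := by
  unfold cnt
  obtain ⟨r, rfl⟩ : ∃ r, k = i + 1 + r + 1 := ⟨k - i - 2, by omega⟩
  have : i + 1 + r + 1 - 1 = i + 1 + r := by omega
  rw [this, sum_range_add _ (i + 1) r, sum_range_add _ (i + 1) r, sum_range_succ _ i, sum_range_succ _ i, rv_sum]
  have h1 : rv i p i = p 0 := by rw [rv_le le_rfl]; simp
  have h2 : rv i p (i + 1) = p (i + 1) := rv_gt (by omega)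
  have h3 : ∀ x, ind (G.Adj (rv i p (i + 1 + x)) (rv i p (i + 1 + x + 1))) =
     ind (G.Adj (p (i + 1 + x)) (p (i + 1 + x + 1))) := by
    intro x; rw [rv_gt (by omega), rv_gt (by omega)]
  simp only [h1, h2, h3]
  omega

theorem ind_true {P : Prop} (h : P) : ind P = 1 := if_pos h
theorem ind_false {P : Prop} (h : ¬ P) : ind P = 0 := if_neg h

theorem cnt_mono {G G' : SimpleGraph V} {k : ℕ} {p : ℕ → V}
    (h : ∀ i, i + 1 < k → G.Adj (p i) (p (i + 1)) → G'.Adj (p i) (p (i + 1))) :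
    cnt G k p ≤ cnt G' k p := by
  apply sum_le_sum
  intro i hi
  rw [mem_range] at hi
  by_cases h1 : G.Adj (p i) (p (i + 1))
  · rw [ind_true h1, ind_true (h i (by omega) h1)]
  · rw [ind_false h1]; exact Nat.zero_le _

theorem cnt_le (G : SimpleGraph V) (k : ℕ) (p : ℕ → V) : cnt G k p ≤ k - 1 := by
  unfold cnt
  calc _ ≤ ∑ i ∈ range (k - 1), 1 := sum_le_sum (fun i _ => by unfold ind; split_ifs <;> omega)
    _ = _ := by simp

/-- A configuration of maximum count with adjacent ends is a full cycle. -/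
theorem fin_adj {G : SimpleGraph V} {k M : ℕ} {T : Finset V} {p : ℕ → V}
    (hp : Lay k T p) (hM : ∀ q, Lay k T q → cnt G k q ≤ M) (hc : cnt G k p = M)
    (h : G.Adj (p 0) (p (k - 1))) : ∀ i, i + 1 < k → G.Adj (p i) (p (i + 1)) := by
  intro i hi
  by_contra hn
  have h1 := cnt_rv G p hi
  rw [ind_false hn] at h1
  have o1 := rv_ord (i := i) (by omega) hp
  have h2 := hM _ o1
  by_cases h0 : G.Adj (p 0) (p (i + 1))
  · rw [ind_true h0] at h1; omega
  rw [ind_false h0] at h1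
  -- reverse everything
  set q := rv (k - 1) (rv i p) with hq
  have o2 : Lay k T q := rv_ord (by omega) o1
  have c2 : cnt G k q = M := by rw [hq, cnt_rv_full]; omega
  -- q = p_{k-1}, ..., p_{i+1}, p_0, ..., p_i
  have q0 : q 0 = p (k - 1) := by rw [hq, rv_le (by omega), rv_gt (by omega)]; rfl
  have qa : q (k - 2 - i) = p (i + 1) := by
    rw [hq, rv_le (by omega), rv_gt (by omega)]; congr 1; omega
  have qb : q (k - 2 - i + 1) = p 0 := by
    rw [hq, rv_le (by omega), rv_le (by omega)]; congr 1; omega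
  have h3 := cnt_rv G q (k := k) (i := k - 2 - i) (by omega)
  rw [qa, qb, q0, ind_false (fun h => h0 h.symm), ind_true h.symm] at h3
  have := hM _ (rv_ord (i := k - 2 - i) (by omega) o2)
  omega

theorem walk_of_seq {G : SimpleGraph V} {k : ℕ} {p : ℕ → V}
    (hadj : ∀ i, i + 1 < k → G.Adj (p i) (p (i + 1))) (i : ℕ) (hi : i < k) :
    ∃ w : G.Walk (p 0) (p i), w.length = i ∧ (∀ x ∈ w.support, ∃ j ≤ i, x = p j) ∧
      (∀ e ∈ w.edges, ∃ j < i, e = s(p j, p (j + 1))) ∧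
      ((∀ i < k, ∀ j < k, p i = p j → i = j) → w.IsPath) := by
  induction i with
  | zero => exact ⟨SimpleGraph.Walk.nil, rfl, by simp, by simp, by simp⟩
  | succ i ih =>
    obtain ⟨w, h1, h2, h3, h4⟩ := ih (by omega)
    refine ⟨w.concat (hadj i hi), by simp [h1], ?_, ?_, ?_⟩
    · intro x hx
      rw [SimpleGraph.Walk.support_concat] at hx
      simp only [List.concat_eq_append, List.mem_append, List.mem_singleton] at hx
      rcases hx with hx | hx
      · obtain ⟨j, hj, rfl⟩ := h2 x hx; exact ⟨j, by omega, rfl⟩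
      · exact ⟨i + 1, le_rfl, hx⟩
    · intro e he
      rw [SimpleGraph.Walk.edges_concat] at he
      simp only [List.concat_eq_append, List.mem_append, List.mem_singleton] at he
      rcases he with hx | hx
      · obtain ⟨j, hj, rfl⟩ := h3 e hx; exact ⟨j, by omega, rfl⟩
      · exact ⟨i, by omega, hx⟩
    · intro hinj
      rw [SimpleGraph.Walk.isPath_def, SimpleGraph.Walk.support_concat,
        List.nodup_append]
      refine ⟨(h4 hinj).support_nodup, by simp, ?_⟩
      intro a ha b hb
      rw [List.mem_singleton] at hb
      obtain ⟨j, hj, rfl⟩ := h2 a ha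
      rintro e
      rw [hb] at e
      have := hinj _ (by omega) _ hi e
      omega

theorem cycle_of_seq {G : SimpleGraph V} {k : ℕ} {p : ℕ → V} (hk : 3 ≤ k)
    (hinj : ∀ i < k, ∀ j < k, p i = p j → i = j)
    (hadj : ∀ i, i + 1 < k → G.Adj (p i) (p (i + 1))) (h : G.Adj (p 0) (p (k - 1))) :
    ∃ (v : V) (c : G.Walk v v), c.IsCycle ∧ c.length = k := by
  obtain ⟨w, h1, h2, h3, h4⟩ := walk_of_seq hadj (k - 1) (by omega)
  refine ⟨_, SimpleGraph.Walk.cons h.symm w, ?_, by simp [h1]; omega⟩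
  rw [SimpleGraph.Walk.cons_isCycle_iff]
  refine ⟨h4 hinj, ?_⟩
  intro he
  obtain ⟨j, hj, e⟩ := h3 _ he
  rw [Sym2.eq_iff] at e
  rcases e with ⟨e1, e2⟩ | ⟨e1, e2⟩
  · have := hinj _ (by omega) _ (by omega) e1; omega
  · have := hinj _ (by omega) _ (by omega) e1
    have := hinj _ (by omega) _ (by omega) e2; omega
end Helpers


section Core
open Classical

variable {V : Type*} [Fintype V]

structure Ctx (d : V → ℕ) (T : Finset V) (k m M : ℕ) : Prop where
  hk : k = 2 * m + 2
  hm : 2 ≤ m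
  top : ∀ t ∈ T, ∀ z, z ∉ T → d z ≤ d t
  H : ∀ i, 1 ≤ i → i ≤ m → (T.filter (fun t => d t ≤ i)).card < i
  max : ∀ G p, Rlz G d → Lay k T p → cnt G k p ≤ M
  nadj : ∀ G p, Rlz G d → Lay k T p → cnt G k p = M → ¬ G.Adj (p 0) (p (k - 1))

structure Good (d : V → ℕ) (T : Finset V) (k M : ℕ) (G : SimpleGraph V) (p : ℕ → V) : Prop where
  r : Rlz G d
  o : Lay k T p
  c : cnt G k p = M

variable {d : V → ℕ} {T : Finset V} {k m M : ℕ} {G : SimpleGraph V} {p : ℕ → V}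

theorem Good.mem (g : Good d T k M G p) {i : ℕ} (hi : i < k) : p i ∈ T := (g.o.2 _).2 ⟨i, hi, rfl⟩

theorem Good.inj (g : Good d T k M G p) {i j : ℕ} (hi : i < k) (hj : j < k) (h : p i = p j) :
    i = j := g.o.1 i hi j hj h

theorem Ctx.na (C : Ctx d T k m M) (g : Good d T k M G p) : ¬ G.Adj (p 0) (p (k - 1)) :=
  C.nadj G p g.r g.o g.c

theorem Ctx.full (C : Ctx d T k m M) (g : Good d T k M G p) : Good d T k M G (rv (k - 1) p) :=
  ⟨g.r, rv_ord (by have := C.hk; omega) g.o, by rw [cnt_rv_full, g.c]⟩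

theorem Ctx.rev (C : Ctx d T k m M) (g : Good d T k M G p) {i : ℕ} (hi : i + 1 < k)
    (h : G.Adj (p 0) (p (i + 1)) ∨ ¬ G.Adj (p i) (p (i + 1))) : Good d T k M G (rv i p) := by
  have o := rv_ord (i := i) (by omega) g.o
  refine ⟨g.r, o, ?_⟩
  have h1 := cnt_rv G p hi
  have h2 := C.max G _ g.r o
  have h3 := g.c
  have h4 : ind (G.Adj (p i) (p (i + 1))) ≤ 1 := by unfold ind; split_ifs <;> omega
  rcases h with h | h
  · rw [ind_true h] at h1; omega
  · rw [ind_false h] at h1; omega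

theorem Ctx.join (C : Ctx d T k m M) (g : Good d T k M G p) {a b : V}
    (ha : G.Adj (p 0) a) (ha1 : a ≠ p 1) (hb : G.Adj (p (k - 1)) b) (hb1 : b ≠ p (k - 2))
    (hab : a ≠ b) : G.Adj a b := by
  by_contra hn
  have hk := C.hk
  have hm := C.hm
  have huv : p 0 ≠ p (k - 1) := fun h => by
    have := g.inj (by omega) (by omega) h; omega
  have R := sw_real g.r huv hab ha hb (C.na g) hn
  have cm : cnt G k p ≤ cnt (swGraph G (p 0) a (p (k - 1)) b huv hab) k p := by
    apply cnt_mono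
    intro i hi h
    rw [swGraph_adj]
    left
    refine ⟨h, ?_, ?_⟩
    · intro e
      rw [Sym2.eq_iff] at e
      rcases e with ⟨e1, e2⟩ | ⟨e1, e2⟩
      · have := g.inj (by omega) (by omega) e1
        subst this; exact ha1 e2.symm
      · have := g.inj (by omega) (by omega) e2; omega
    · intro e
      rw [Sym2.eq_iff] at e
      rcases e with ⟨e1, e2⟩ | ⟨e1, e2⟩
      · have := g.inj (by omega) (by omega) e1; omega
      · have := g.inj (by omega) (by omega) e2
        apply hb1; rw [← e1]; congr 1; omega
  have c1 := C.max _ p R g.o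
  have := g.c
  exact C.nadj _ p R g.o (by omega) (swGraph_adj.2 (Or.inr (Or.inl rfl)))

theorem rv_full_0 (k : ℕ) (p : ℕ → V) : rv (k - 1) p 0 = p (k - 1) := by
  rw [rv_le (Nat.zero_le _)]; rfl
theorem rv_full_last (k : ℕ) (p : ℕ → V) : rv (k - 1) p (k - 1) = p 0 := by
  rw [rv_le le_rfl]; simp
theorem rv_full_1 {k : ℕ} (hk : 2 ≤ k) (p : ℕ → V) : rv (k - 1) p 1 = p (k - 2) := by
  rw [rv_le (by omega)]; rfl
theorem rv_full_2 {k : ℕ} (hk : 2 ≤ k) (p : ℕ → V) : rv (k - 1) p (k - 2) = p 1 := by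
  rw [rv_le (by omega)]; congr 1; omega

/-- neighbours of the first vertex other than the second -/
noncomputable def sA (G : SimpleGraph V) (p : ℕ → V) : Finset V := (nb G (p 0)).erase (p 1)
noncomputable def sB (k : ℕ) (G : SimpleGraph V) (p : ℕ → V) : Finset V :=
  (nb G (p (k - 1))).erase (p (k - 2))

theorem mem_sA {x : V} : x ∈ sA G p ↔ x ≠ p 1 ∧ G.Adj (p 0) x := by simp [sA, mem_nb]
theorem mem_sB {x : V} : x ∈ sB k G p ↔ x ≠ p (k - 2) ∧ G.Adj (p (k - 1)) x := by simp [sB, mem_nb]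

theorem sA_full (hk : 2 ≤ k) : sA G (rv (k - 1) p) = sB k G p := by
  unfold sA sB; rw [rv_full_0, rv_full_1 hk]
theorem sB_full (hk : 2 ≤ k) : sB k G (rv (k - 1) p) = sA G p := by
  unfold sA sB; rw [rv_full_last, rv_full_2 hk]

theorem Ctx.card_sA (g : Good d T k M G p) : d (p 0) ≤ (sA G p).card + 1 := by
  rw [← g.r (p 0)]; exact Nat.le_add_of_sub_le pred_card_le_card_erase

theorem Ctx.card_sB (g : Good d T k M G p) : d (p (k - 1)) ≤ (sB k G p).card + 1 := by
  rw [← g.r (p (k - 1))]; exact Nat.le_add_of_sub_le pred_card_le_card_erase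

theorem Good.off_ne (g : Good d T k M G p) {z : V} (hz : z ∉ T) {i : ℕ} (hi : i < k) : z ≠ p i := by
  rintro rfl; exact hz (g.mem hi)

/-- Outside vertex adjacent to the last end only. -/
theorem Ctx.one (C : Ctx d T k m M) (g : Good d T k M G p) {z : V} (hz : z ∉ T)
    (hv : G.Adj (p (k - 1)) z) (hu : ¬ G.Adj (p 0) z) :
    d z = d (p 0) ∧ (sA G p).card + 1 = d (p 0) ∧ nb G z = insert (p (k - 1)) (sA G p) := by
  have hk := C.hk
  have hm := C.hm
  have hsub : insert (p (k - 1)) (sA G p) ⊆ nb G z := by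
    intro x hx
    rw [mem_insert, mem_sA] at hx
    rw [mem_nb]
    rcases hx with rfl | ⟨h1, h2⟩
    · exact hv.symm
    · exact (C.join g h2 h1 hv (g.off_ne hz (by omega)) (by rintro rfl; exact hu h2)).symm
  have hni : p (k - 1) ∉ sA G p := fun h => C.na g (mem_sA.1 h).2
  have h1 := card_le_card hsub
  rw [card_insert_of_notMem hni, g.r z] at h1
  have h2 := Ctx.card_sA g
  have h3 := C.top (p 0) (g.mem (by omega)) z hz
  refine ⟨by omega, by omega, (eq_of_subset_of_card_le hsub ?_).symm⟩
  rw [card_insert_of_notMem hni, g.r z]; omega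

/-- Outside vertex adjacent to both ends. -/
theorem Ctx.two (C : Ctx d T k m M) (g : Good d T k M G p) {z : V} (hz : z ∉ T)
    (hv : G.Adj (p (k - 1)) z) (hu : G.Adj (p 0) z) :
    d z = d (p 0) ∧ d z = d (p (k - 1)) ∧ (sA G p).card + 1 = d (p 0) ∧ sA G p = sB k G p ∧
    nb G z = insert (p 0) (insert (p (k - 1)) ((sA G p).erase z)) := by
  have hk := C.hk
  have hm := C.hm
  have zA : z ∈ sA G p := mem_sA.2 ⟨g.off_ne hz (by omega), hu⟩
  have zB : z ∈ sB k G p := mem_sB.2 ⟨g.off_ne hz (by omega), hv⟩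
  have hsub : insert (p 0) (insert (p (k - 1)) ((sA G p ∪ sB k G p).erase z)) ⊆ nb G z := by
    intro x hx
    rw [mem_insert, mem_insert, mem_erase, mem_union, mem_sA, mem_sB] at hx
    rw [mem_nb]
    rcases hx with rfl | rfl | ⟨hxz, ⟨h1, h2⟩ | ⟨h1, h2⟩⟩
    · exact hu.symm
    · exact hv.symm
    · exact (C.join g h2 h1 hv (g.off_ne hz (by omega)) hxz).symm
    · exact (C.join g hu (g.off_ne hz (by omega)) h2 h1 hxz.symm)
  have hni1 : p (k - 1) ∉ (sA G p ∪ sB k G p).erase z := by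
    rw [mem_erase, mem_union, mem_sA, mem_sB]
    rintro ⟨-, ⟨-, h⟩ | ⟨-, h⟩⟩
    · exact C.na g h
    · exact h.ne rfl
  have hni0 : p 0 ∉ insert (p (k - 1)) ((sA G p ∪ sB k G p).erase z) := by
    rw [mem_insert, mem_erase, mem_union, mem_sA, mem_sB]
    rintro (h | ⟨-, ⟨-, h⟩ | ⟨-, h⟩⟩)
    · have := g.inj (by omega) (by omega) h; omega
    · exact h.ne rfl
    · exact C.na g h.symm
  have h1 := card_le_card hsub
  have hc : (insert (p 0) (insert (p (k - 1)) ((sA G p ∪ sB k G p).erase z))).card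
      = (sA G p ∪ sB k G p).card + 1 := by
    rw [card_insert_of_notMem hni0, card_insert_of_notMem hni1,
      card_erase_of_mem (mem_union_left _ zA)]
    have := card_pos.2 ⟨z, mem_union_left (sB k G p) zA⟩
    omega
  rw [hc, g.r z] at h1
  have h2 := Ctx.card_sA g
  have h2' := Ctx.card_sB g
  have h3 := C.top (p 0) (g.mem (by omega)) z hz
  have h3' := C.top (p (k - 1)) (g.mem (by omega)) z hz
  have h4 := card_le_card (subset_union_left (s₁ := sA G p) (s₂ := sB k G p))
  have h5 := card_le_card (subset_union_right (s₁ := sA G p) (s₂ := sB k G p))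
  have e1 := eq_of_subset_of_card_le (subset_union_left (s₁ := sA G p) (s₂ := sB k G p)) (by omega)
  have e2 := eq_of_subset_of_card_le (subset_union_right (s₁ := sA G p) (s₂ := sB k G p)) (by omega)
  refine ⟨by omega, by omega, by omega, e1.trans e2.symm, ?_⟩
  have := eq_of_subset_of_card_le hsub (by rw [hc, g.r z]; omega)
  rw [← e1] at this
  exact this.symm

theorem rv_0 (i : ℕ) (p : ℕ → V) : rv i p 0 = p i := by rw [rv_le (Nat.zero_le _)]; rfl
theorem rv_1 {i : ℕ} (hi : 1 ≤ i) (p : ℕ → V) : rv i p 1 = p (i - 1) := by rw [rv_le hi]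

/-- end rotated to `p i`, with an outside neighbour `z` of the last end -/
theorem Ctx.rot (C : Ctx d T k m M) (g : Good d T k M G p) {z : V} (hz : z ∉ T)
    (hv : G.Adj (p (k - 1)) z) {i : ℕ} (hi1 : 1 ≤ i) (hi : i + 1 < k)
    (h : G.Adj (p 0) (p (i + 1)) ∨ ¬ G.Adj (p i) (p (i + 1))) :
    ¬ G.Adj (p i) (p (k - 1)) ∧
    ∀ a, G.Adj (p i) a → a ≠ p (i - 1) → a ≠ z → G.Adj a z := by
  have hk := C.hk
  have g' := C.rev g hi h
  have l0 : rv i p 0 = p i := rv_0 i p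
  have l1 : rv i p 1 = p (i - 1) := rv_1 hi1 p
  have ll : rv i p (k - 1) = p (k - 1) := rv_gt (by omega)
  constructor
  · have := C.na g'; rwa [l0, ll] at this
  · intro a ha ha1 haz
    have hz' : z ≠ rv i p (k - 2) := g'.off_ne hz (by omega)
    exact C.join g' (by rwa [l0]) (by rwa [l1]) (by rwa [ll]) hz' haz

theorem Ctx.shift (C : Ctx d T k m M) (g : Good d T k M G p) (hmin : ∀ t ∈ T, d (p 0) ≤ d t)
    {z : V} (hz : z ∉ T)
    (hv : G.Adj (p (k - 1)) z) (hu : ¬ G.Adj (p 0) z) {i : ℕ} (hi1 : 1 ≤ i) (hi : i + 1 < k)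
    (h : p (i + 1) ∈ sA G p) : p i ∉ sA G p ∧ (nb G (p i)).erase (p (i - 1)) = sA G p := by
  have hk := C.hk
  obtain ⟨e1, e2, e3⟩ := C.one g hz hv hu
  obtain ⟨r1, r2⟩ := C.rot g hz hv hi1 hi (Or.inl (mem_sA.1 h).2)
  have hz3 : ∀ a, G.Adj z a ↔ (a = p (k - 1) ∨ a ∈ sA G p) := by
    intro a; rw [← mem_nb, e3, mem_insert]
  have hsub : ∀ a, G.Adj (p i) a → a ≠ p (i - 1) → a ≠ z → a ∈ sA G p := by
    intro a h1 h2 h3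
    have := (hz3 a).1 (r2 a h1 h2 h3).symm
    rcases this with rfl | h
    · exact absurd h1 r1
    · exact h
  have hA : p i ∉ sA G p := by
    intro hc
    have hu' := (mem_sA.1 hc).2
    have hi2 : i ≠ 1 := by rintro rfl; exact (mem_sA.1 hc).1 rfl
    have := hsub (p 0) hu'.symm (fun h => by have := g.inj (by omega) (by omega) h; omega)
      (g.off_ne hz (by omega)).symm
    exact (mem_sA.1 this).2.ne rfl
  refine ⟨hA, eq_of_subset_of_card_le ?_ ?_⟩
  · intro a ha
    rw [mem_erase, mem_nb] at ha
    refine hsub a ha.2 ha.1 ?_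
    rintro rfl
    rcases (hz3 (p i)).1 ha.2.symm with h | h
    · have := g.inj (by omega) (by omega) h; omega
    · exact hA h
  · have h1 : (nb G (p i)).card - 1 ≤ _ := pred_card_le_card_erase (a := p (i - 1))
    rw [g.r] at h1
    have := hmin (p i) (g.mem (by omega))
    omega

structure Best (d : V → ℕ) (T : Finset V) (k M : ℕ) (G : SimpleGraph V) (p : ℕ → V) : Prop
    extends Good d T k M G p where
  best : ∀ G' p', Good d T k M G' p' → d (p' 0) + d (p' (k - 1)) ≤ d (p 0) + d (p (k - 1))

theorem Ctx.bfull (C : Ctx d T k m M) (g : Best d T k M G p) : Best d T k M G (rv (k - 1) p) :=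
  ⟨C.full g.toGood, by
    intro G' p' g'
    rw [rv_full_0, rv_full_last]
    have := g.best G' p' g'
    omega⟩

theorem Ctx.pred_le (C : Ctx d T k m M) (g : Best d T k M G p) {i : ℕ} (hi : i + 1 < k)
    (h : G.Adj (p 0) (p (i + 1))) : d (p i) ≤ d (p 0) := by
  have := g.best G _ (C.rev g.toGood hi (Or.inl h))
  rw [rv_0, rv_gt (by omega : i < k - 1)] at this
  omega

theorem Ctx.deg (C : Ctx d T k m M) : ∀ t ∈ T, 2 ≤ d t := by
  intro t ht
  by_contra h
  have := C.H 1 le_rfl (by have := C.hm; omega)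
  have : 0 < (T.filter (fun t => d t ≤ 1)).card := card_pos.2 ⟨t, mem_filter.2 ⟨ht, by omega⟩⟩
  omega

theorem card_idx (g : Good d T k M G p) {s : Finset V} (h : s ⊆ T) :
    ((range k).filter (fun j => p j ∈ s)).card = s.card := by
  have : s = ((range k).filter (fun j => p j ∈ s)).image p := by
    ext x
    simp only [mem_image, mem_filter, mem_range]
    constructor
    · intro hx
      obtain ⟨i, hi, rfl⟩ := (g.o.2 x).1 (h hx)
      exact ⟨i, ⟨hi, hx⟩, rfl⟩
    · rintro ⟨i, ⟨hi, hx⟩, rfl⟩; exact hx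
  conv_rhs => rw [this]
  rw [card_image_of_injOn]
  intro i hi j hj e
  simp only [coe_filter, mem_range, Set.mem_setOf_eq] at hi hj
  exact g.inj hi.1 hj.1 e

theorem Ctx.posa (C : Ctx d T k m M) (g : Best d T k M G p)
    (hu : ∀ z, G.Adj (p 0) z → z ∈ T) (hd : d (p 0) ≤ m) : False := by
  have hk := C.hk
  have h2 := C.deg (p 0) (g.mem (by omega))
  have h3 := C.H (d (p 0)) (by omega) hd
  have hc := card_idx g.toGood (s := nb G (p 0)) (fun z hz => hu z (mem_nb.1 hz))
  rw [g.r] at hc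
  have : ((range k).filter (fun j => p j ∈ nb G (p 0))).card ≤
      (T.filter (fun t => d t ≤ d (p 0))).card := by
    have pos : ∀ j ∈ (range k).filter (fun j => p j ∈ nb G (p 0)), 1 ≤ j ∧ j < k ∧ G.Adj (p 0) (p j) := by
      intro j hj
      rw [mem_filter, mem_nb, mem_range] at hj
      refine ⟨?_, hj⟩
      rcases Nat.eq_zero_or_pos j with rfl | h
      · exact absurd rfl hj.2.ne
      · exact h
    apply card_le_card_of_injOn (fun j => p (j - 1))
    · intro j hj
      obtain ⟨a, b, c⟩ := pos j hj
      simp only [coe_filter, Set.mem_setOf_eq]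
      refine ⟨g.mem (by omega), C.pred_le g (by omega) ?_⟩
      rwa [Nat.sub_add_cancel a]
    · intro i hi j hj e
      obtain ⟨a, b, c⟩ := pos j hj
      obtain ⟨a', b', c'⟩ := pos i hi
      have := g.inj (by omega) (by omega) e
      omega
  omega

/-- no outside neighbour at the first (smaller) end -/
theorem Ctx.caseA (C : Ctx d T k m M) (g : Best d T k M G p) (hle : d (p 0) ≤ d (p (k - 1)))
    (hu : ∀ z, G.Adj (p 0) z → z ∈ T) : False := by
  have hk := C.hk
  have hm := C.hm
  by_cases hd : d (p 0) ≤ m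
  · exact C.posa g hu hd
  push Not at hd
  by_cases hv : ∀ z, G.Adj (p (k - 1)) z → z ∈ T
  · -- crossing
    have c1 := card_idx g.toGood (s := nb G (p 0)) (fun z hz => hu z (mem_nb.1 hz))
    have c2 := card_idx g.toGood (s := nb G (p (k - 1))) (fun z hz => hv z (mem_nb.1 hz))
    rw [g.r] at c1 c2
    set I := (range k).filter (fun j => p j ∈ nb G (p 0)) with hI
    set J := (range k).filter (fun j => p j ∈ nb G (p (k - 1))) with hJ
    have pos : ∀ j ∈ I, 1 ≤ j ∧ j < k ∧ G.Adj (p 0) (p j) := by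
      intro j hj
      rw [hI, mem_filter, mem_nb, mem_range] at hj
      refine ⟨?_, hj⟩
      rcases Nat.eq_zero_or_pos j with rfl | h
      · exact absurd rfl hj.2.ne
      · exact h
    have posJ : ∀ j ∈ J, j < k - 1 ∧ G.Adj (p (k - 1)) (p j) := by
      intro j hj
      rw [hJ, mem_filter, mem_nb, mem_range] at hj
      refine ⟨?_, hj.2⟩
      rcases Nat.lt_or_ge j (k - 1) with h | h
      · exact h
      · have : j = k - 1 := by omega
        subst this
        exact absurd rfl hj.2.ne
    have c3 : (I.image (fun j => j - 1)).card = I.card := by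
      apply card_image_of_injOn
      intro i hi j hj e
      have a := pos i hi
      have b := pos j hj
      simp only at e
      omega
    have dis : Disjoint (I.image (fun j => j - 1)) J := by
      rw [disjoint_left]
      intro x hx hxJ
      rw [mem_image] at hx
      obtain ⟨j, hj, rfl⟩ := hx
      obtain ⟨a, b, c⟩ := pos j hj
      obtain ⟨a', b'⟩ := posJ _ hxJ
      have g' := C.rev g.toGood (i := j - 1) (by omega) (Or.inl (by rwa [Nat.sub_add_cancel a]))
      have := C.na g'
      rw [rv_0, rv_gt (by omega)] at this
      exact this b'.symm
    have sub : (I.image (fun j => j - 1)) ∪ J ⊆ range (k - 1) := by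
      intro x hx
      rw [mem_union, mem_image] at hx
      rw [mem_range]
      rcases hx with ⟨j, hj, rfl⟩ | hx
      · have := pos j hj; omega
      · exact (posJ x hx).1
    have := card_le_card sub
    rw [card_union_of_disjoint dis, card_range] at this
    omega
  · push Not at hv
    obtain ⟨z, hvz, hz⟩ := hv
    have hun : ¬ G.Adj (p 0) z := fun h => hz (hu z h)
    obtain ⟨e1, e2, e3⟩ := C.one g.toGood hz hvz hun
    have hmin : ∀ t ∈ T, d (p 0) ≤ d t := fun t ht => by
      have := C.top t ht z hz; omega
    have hAT : sA G p ⊆ T := fun x hx => hu x (mem_sA.1 hx).2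
    have c1 := card_idx g.toGood hAT
    set I := (range k).filter (fun j => p j ∈ sA G p) with hI
    have pos : ∀ j ∈ I, 2 ≤ j ∧ j + 1 < k ∧ p j ∈ sA G p := by
      intro j hj
      rw [hI, mem_filter, mem_range] at hj
      refine ⟨?_, ?_, hj.2⟩
      · by_contra hlt
        have : j = 0 ∨ j = 1 := by omega
        rcases this with rfl | rfl
        · exact (mem_sA.1 hj.2).2.ne rfl
        · exact (mem_sA.1 hj.2).1 rfl
      · by_contra hlt
        have : j = k - 1 := by omega
        subst this
        exact C.na g.toGood (mem_sA.1 hj.2).2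
    have gap : ∀ j ∈ I, j - 1 ∉ I ∧ j - 2 ∉ I := by
      intro j hj
      obtain ⟨a, b, c⟩ := pos j hj
      obtain ⟨s1, s2⟩ := C.shift g.toGood hmin hz hvz hun (i := j - 1) (by omega) (by omega)
        (by rwa [Nat.sub_add_cancel (by omega)])
      constructor
      · intro h; exact s1 (pos _ h).2.2
      · intro h
        have := (pos _ h).2.2
        rw [← s2, mem_erase] at this
        exact this.1 (by congr 1)
    have d1 : Disjoint I (I.image (· + 1)) := by
      rw [disjoint_left]; intro x hx hx'
      rw [mem_image] at hx'; obtain ⟨j, hj, rfl⟩ := hx'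
      exact (gap _ hx).1 (by simpa using hj)
    have d2 : Disjoint (I ∪ I.image (· + 1)) (I.image (· + 2)) := by
      rw [disjoint_left]; intro x hx hx'
      rw [mem_image] at hx'; obtain ⟨j, hj, rfl⟩ := hx'
      rw [mem_union, mem_image] at hx
      rcases hx with hx | ⟨l, hl, e⟩
      · exact (gap _ hx).2 (by simpa using hj)
      · have : l = j + 1 := by omega
        subst this
        exact (gap _ hl).1 (by simpa using hj)
    have sub : (I ∪ I.image (· + 1)) ∪ I.image (· + 2) ⊆ Ico 2 (k + 1) := by
      intro x hx
      simp only [mem_union, mem_image] at hx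
      rw [mem_Ico]
      rcases hx with (hx | ⟨j, hj, rfl⟩) | ⟨j, hj, rfl⟩
      · have := pos _ hx; omega
      · have := pos _ hj; omega
      · have := pos _ hj; omega
    have := card_le_card sub
    rw [card_union_of_disjoint d2, card_union_of_disjoint d1,
      card_image_of_injective _ (add_left_injective 1),
      card_image_of_injective _ (add_left_injective 2), Nat.card_Ico] at this
    omega
end Core

section Core2
open Classical

variable {V : Type*} [Fintype V]
variable {d : V → ℕ} {T : Finset V} {k m M : ℕ} {G : SimpleGraph V} {p : ℕ → V}

theorem cnt_mono2 {G G' : SimpleGraph V} {k : ℕ} {p q : ℕ → V}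
    (h : ∀ i, i + 1 < k → G.Adj (p i) (p (i + 1)) → G'.Adj (q i) (q (i + 1))) :
    cnt G k p ≤ cnt G' k q := by
  apply sum_le_sum
  intro i hi
  rw [mem_range] at hi
  by_cases h1 : G.Adj (p i) (p (i + 1))
  · rw [ind_true h1, ind_true (h i (by omega) h1)]
  · rw [ind_false h1]; omega

theorem Ctx.close (C : Ctx d T k m M) (g : Good d T k M G p) {a b : V} (haT : a ∉ T) (hbT : b ∉ T)
    (ha : G.Adj (p 0) a) (hb : G.Adj (p (k - 1)) b) (hab : a ≠ b)
    (ha1 : ¬ G.Adj (p 1) a) (hb1 : ¬ G.Adj (p 1) b) (hu2 : ¬ G.Adj (p 0) (p 2))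
    (hN : ∀ w, G.Adj w b → w ≠ p 0 → w ≠ p (k - 1) → ¬ G.Adj (p 1) w)
    (hd : 3 ≤ d (p 1)) : False := by
  have hk := C.hk
  have hm := C.hm
  have key : ∃ G', Good d T k M G' (rv 1 p) ∧ (∀ x, G.Adj (p 1) x → x ≠ p 2 → G'.Adj (p 1) x) ∧
      G'.Adj (p (k - 1)) b ∧ ∀ x, G'.Adj x b → G.Adj x b := by
    by_cases h12 : G.Adj (p 1) (p 2)
    · have h02 : p 0 ≠ p 2 := fun h => by
        have := g.inj (by omega) (by omega) h; omega
      have h01 : p 0 ≠ p 1 := fun h => by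
        have := g.inj (by omega) (by omega) h; omega
      have hap : a ≠ p 1 := g.off_ne haT (by omega)
      have R := sw_real g.r h02 hap ha h12.symm hu2 (fun h => ha1 h.symm)
      have o := rv_ord (i := 1) (by omega) g.o
      refine ⟨_, ⟨R, o, ?_⟩, ?_, ?_, ?_⟩
      · refine le_antisymm (C.max _ _ R o) ?_
        rw [← g.c]
        apply cnt_mono2
        intro i hi h
        rcases (by omega : i = 0 ∨ i = 1 ∨ 2 ≤ i) with rfl | rfl | h2
        · rw [rv_0, rv_1 le_rfl, swGraph_adj]
          left
          refine ⟨h.symm, ?_, ?_⟩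
          · rw [Ne, Sym2.eq_iff]; rintro (⟨e, -⟩ | ⟨e, -⟩)
            · exact h01 e.symm
            · exact hap e.symm
          · rw [Ne, Sym2.eq_iff]; rintro (⟨-, e⟩ | ⟨-, e⟩)
            · exact h01 e
            · exact h02 e
        · rw [rv_1 le_rfl, rv_gt (by omega), swGraph_adj]
          right; left; rfl
        · rw [rv_gt (by omega), rv_gt (by omega), swGraph_adj]
          left
          refine ⟨h, ?_, ?_⟩
          · rw [Ne, Sym2.eq_iff]; rintro (⟨e, -⟩ | ⟨-, e⟩)
            · have := g.inj (by omega) (by omega) e; omega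
            · have := g.inj (by omega) (by omega) e; omega
          · rw [Ne, Sym2.eq_iff]; rintro (⟨-, e⟩ | ⟨e, -⟩)
            · have := g.inj (by omega) (by omega) e; omega
            · have := g.inj (by omega) (by omega) e; omega
      · intro x hx hx2
        rw [swGraph_adj]
        left
        refine ⟨hx, ?_, ?_⟩
        · rw [Ne, Sym2.eq_iff]; rintro (⟨e, -⟩ | ⟨e, -⟩)
          · exact h01 e.symm
          · exact hap e.symm
        · rw [Ne, Sym2.eq_iff]; rintro (⟨e, -⟩ | ⟨-, e⟩)
          · have := g.inj (by omega) (by omega) e; omega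
          · exact hx2 e
      · rw [swGraph_adj]
        left
        refine ⟨hb, ?_, ?_⟩
        · rw [Ne, Sym2.eq_iff]; rintro (⟨-, e⟩ | ⟨-, e⟩)
          · exact hab e.symm
          · exact g.off_ne hbT (by omega) e
        · rw [Ne, Sym2.eq_iff]; rintro (⟨-, e⟩ | ⟨-, e⟩)
          · exact g.off_ne hbT (by omega) e
          · exact g.off_ne hbT (by omega) e
      · intro x hx
        rw [swGraph_adj, Sym2.eq_iff, Sym2.eq_iff] at hx
        rcases hx with ⟨h, -⟩ | (⟨-, e⟩ | ⟨-, e⟩) | (⟨-, e⟩ | ⟨-, e⟩)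
        · exact h
        · exact absurd e (g.off_ne hbT (by omega))
        · exact absurd e (g.off_ne hbT (by omega))
        · exact absurd e (g.off_ne hbT (by omega))
        · exact absurd e hab.symm
    · exact ⟨G, C.rev g (i := 1) (by omega) (Or.inr h12), fun x hx _ => hx, hb, fun x hx => hx⟩
  obtain ⟨G', g', k1, k2, k3⟩ := key
  obtain ⟨y, hy⟩ : (((nb G (p 1)).erase (p 0)).erase (p 2)).Nonempty := by
    rw [← card_pos]
    have h1 : ((nb G (p 1)).erase (p 0)).card - 1 ≤ _ := pred_card_le_card_erase (a := p 2)
    have h2 : (nb G (p 1)).card - 1 ≤ _ := pred_card_le_card_erase (a := p 0)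
    rw [g.r] at h2
    omega
  rw [mem_erase, mem_erase, mem_nb] at hy
  obtain ⟨y2, y0, y1⟩ := hy
  have l0 : rv 1 p 0 = p 1 := rv_0 1 p
  have l1 : rv 1 p 1 = p 0 := rv_1 le_rfl p
  have ll : rv 1 p (k - 1) = p (k - 1) := rv_gt (by omega)
  have yb : y ≠ b := by rintro rfl; exact hb1 y1
  have yv : y ≠ p (k - 1) := by
    rintro rfl
    apply C.na g'
    rw [l0, ll]; exact k1 _ y1 y2
  have := C.join g' (a := y) (b := b) (by rw [l0]; exact k1 _ y1 y2) (by rwa [l1]) (by rwa [ll])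
    (g'.off_ne hbT (by omega)) yb
  exact hN y (k3 _ this) y0 yv y1

theorem Ctx.idx (C : Ctx d T k m M) (g : Good d T k M G p) {x : V} (hx : x ∈ sA G p) (hT : x ∈ T) :
    ∃ i, 1 ≤ i ∧ i + 2 < k ∧ x = p (i + 1) := by
  obtain ⟨j, hj, rfl⟩ := (g.o.2 x).1 hT
  have h0 : j ≠ 0 := by rintro rfl; exact (mem_sA.1 hx).2.ne rfl
  have h1 : j ≠ 1 := by rintro rfl; exact (mem_sA.1 hx).1 rfl
  have h2 : j ≠ k - 1 := by rintro rfl; exact C.na g (mem_sA.1 hx).2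
  exact ⟨j - 1, by omega, by omega, by congr 1; omega⟩

/-- common outside neighbour -/
theorem Ctx.caseB1 (C : Ctx d T k m M) (g : Good d T k M G p) {z : V} (hz : z ∉ T)
    (hv : G.Adj (p (k - 1)) z) (hu : G.Adj (p 0) z) (hd3 : 3 ≤ d (p 0)) : False := by
  have hk := C.hk
  have hm := C.hm
  obtain ⟨e1, e2, e3, e4, e5⟩ := C.two g hz hv hu
  have hmin : ∀ t ∈ T, d (p 0) ≤ d t := fun t ht => by
      have := C.top t ht z hz; omega
  have zA : z ∈ sA G p := mem_sA.2 ⟨g.off_ne hz (by omega), hu⟩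
  have hA : ∀ x ∈ sA G p, x ∉ T := by
    intro x hx hT
    obtain ⟨i, i1, i2, rfl⟩ := C.idx g hx hT
    obtain ⟨r1, r2⟩ := C.rot g hz hv i1 (by omega) (Or.inl (mem_sA.1 hx).2)
    have hpi : p i ∉ sA G p := by
      rw [e4]; intro h; exact r1 (mem_sB.1 h).2.symm
    have hzi : ¬ G.Adj (p i) z := by
      intro h
      have h' := mem_nb.2 h.symm
      rw [e5, mem_insert, mem_insert, mem_erase] at h'
      rcases h' with h' | h' | h'
      · have := g.inj (by omega) (by omega) h'; omega
      · have := g.inj (by omega) (by omega) h'; omega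
      · exact hpi h'.2
    have hsub : (nb G (p i)).erase (p (i - 1)) ⊆ insert (p 0) ((sA G p).erase z) := by
      intro a ha
      rw [mem_erase, mem_nb] at ha
      have haz : a ≠ z := by rintro rfl; exact hzi ha.2
      have h' := mem_nb.2 (r2 a ha.2 ha.1 haz).symm
      rw [e5, mem_insert, mem_insert] at h'
      rw [mem_insert]
      rcases h' with h' | h' | h'
      · exact Or.inl h'
      · subst h'; exact absurd ha.2 r1
      · exact Or.inr h'
    have hc : (insert (p 0) ((sA G p).erase z)).card ≤ ((nb G (p i)).erase (p (i - 1))).card := by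
      have h1 : (nb G (p i)).card - 1 ≤ _ := pred_card_le_card_erase (a := p (i - 1))
      rw [g.r] at h1
      have := hmin (p i) (g.mem (by omega))
      have h3 := card_insert_le (p 0) ((sA G p).erase z)
      rw [card_erase_of_mem zA] at h3
      have := card_pos.2 ⟨z, zA⟩
      omega
    have he := eq_of_subset_of_card_le hsub hc
    have h0 : p 0 ∈ (nb G (p i)).erase (p (i - 1)) := by rw [he]; exact mem_insert_self _ _
    rw [mem_erase, mem_nb] at h0
    apply hpi
    rw [mem_sA]
    refine ⟨?_, h0.2.symm⟩
    intro h
    have := g.inj (by omega) (by omega) h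
    subst this
    exact h0.1 rfl
  have h1A : ∀ x ∈ sA G p, ¬ G.Adj (p 1) x := by
    intro x hx h
    have hxT := hA x hx
    have hxB := hx
    rw [e4] at hxB
    obtain ⟨-, -, -, -, f5⟩ := C.two g hxT (mem_sB.1 hxB).2 (mem_sA.1 hx).2
    have h' := mem_nb.2 h.symm
    rw [f5, mem_insert, mem_insert, mem_erase] at h'
    rcases h' with h' | h' | h'
    · have := g.inj (by omega) (by omega) h'; omega
    · have := g.inj (by omega) (by omega) h'; omega
    · exact (mem_sA.1 h'.2).1 rfl
  obtain ⟨b, hbA, hbz⟩ : ∃ b ∈ sA G p, b ≠ z := by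
    apply exists_mem_ne; omega
  have hbB := hbA
  rw [e4] at hbB
  obtain ⟨-, -, -, -, f5⟩ := C.two g (hA b hbA) (mem_sB.1 hbB).2 (mem_sA.1 hbA).2
  refine C.close g hz (hA b hbA) hu (mem_sB.1 hbB).2 hbz.symm (h1A z zA) (h1A b hbA) ?_ ?_ ?_
  · intro h
    refine hA (p 2) (mem_sA.2 ⟨?_, h⟩) (g.mem (by omega))
    intro h; have := g.inj (by omega) (by omega) h; omega
  · intro w hw w0 wv
    have h' := mem_nb.2 hw.symm
    rw [f5, mem_insert, mem_insert, mem_erase] at h'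
    rcases h' with h' | h' | h'
    · exact absurd h' w0
    · exact absurd h' wv
    · exact h1A w h'.2
  · have := hmin (p 1) (g.mem (by omega)); omega

theorem Ctx.one' (C : Ctx d T k m M) (g : Good d T k M G p) {z : V} (hz : z ∉ T)
    (hv : ¬ G.Adj (p (k - 1)) z) (hu : G.Adj (p 0) z) :
    d z = d (p (k - 1)) ∧ (sB k G p).card + 1 = d (p (k - 1)) ∧ nb G z = insert (p 0) (sB k G p) := by
  have hk := C.hk
  have := C.one (C.full g) hz (by rwa [rv_full_last]) (by rwa [rv_full_0])
  rwa [rv_full_last, rv_full_0, sA_full (by omega)] at this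

theorem Ctx.caseB2a (C : Ctx d T k m M) (g : Good d T k M G p) {z z' : V} (hz : z ∉ T) (hz' : z' ∉ T)
    (hv : ¬ G.Adj (p (k - 1)) z) (hu : G.Adj (p 0) z)
    (hv' : G.Adj (p (k - 1)) z') (hu' : ¬ G.Adj (p 0) z') : ∀ x ∈ sA G p, x ∉ T := by
  have hk := C.hk
  have hm := C.hm
  obtain ⟨e1, e2, e3⟩ := C.one g hz' hv' hu'
  obtain ⟨f1, f2, f3⟩ := C.one' g hz hv hu
  intro x hx hT
  have hmin : ∀ t ∈ T, d (p 0) ≤ d t := fun t ht => by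
      have := C.top t ht z' hz'; omega
  obtain ⟨i, i1, i2, rfl⟩ := C.idx g hx hT
  obtain ⟨r1, r2⟩ := C.rot g hz' hv' i1 (by omega) (Or.inl (mem_sA.1 hx).2)
  obtain ⟨s1, s2⟩ := C.shift g hmin hz' hv' hu' i1 (by omega) hx
  have zA : z ∈ sA G p := mem_sA.2 ⟨g.off_ne hz (by omega), hu⟩
  rw [← s2, mem_erase, mem_nb] at zA
  have h' := mem_nb.2 zA.2.symm
  rw [f3, mem_insert] at h'
  rcases h' with h' | h'
  · have := g.inj (by omega) (by omega) h'; omega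
  · exact r1 (mem_sB.1 h').2.symm

theorem Ctx.caseB2 (C : Ctx d T k m M) (g : Good d T k M G p) {z z' : V} (hz : z ∉ T) (hz' : z' ∉ T)
    (hu : G.Adj (p 0) z) (hv' : G.Adj (p (k - 1)) z')
    (hno : ∀ y, y ∉ T → G.Adj (p 0) y → ¬ G.Adj (p (k - 1)) y) (hd3 : 3 ≤ d (p 0)) : False := by
  have hk := C.hk
  have hm := C.hm
  have hv := hno z hz hu
  have hu' : ¬ G.Adj (p 0) z' := fun h => hno z' hz' h hv'
  have hA := C.caseB2a g hz hz' hv hu hv' hu'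
  have hB : ∀ x ∈ sB k G p, x ∉ T := by
    have := C.caseB2a (C.full g) hz' hz (by rwa [rv_full_last]) (by rwa [rv_full_0])
      (by rwa [rv_full_last]) (by rwa [rv_full_0])
    rwa [sA_full (by omega)] at this
  obtain ⟨e1, e2, e3⟩ := C.one g hz' hv' hu'
  have hmin : ∀ t ∈ T, d (p 0) ≤ d t := fun t ht => by
      have := C.top t ht z' hz'; omega
  have h1T : p 1 ∈ T := g.mem (by omega)
  have h1A : ∀ x ∈ sA G p, ¬ G.Adj (p 1) x := by
    intro x hx h
    obtain ⟨-, -, f3⟩ := C.one' g (hA x hx) (hno x (hA x hx) (mem_sA.1 hx).2) (mem_sA.1 hx).2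
    have h' := mem_nb.2 h.symm
    rw [f3, mem_insert] at h'
    rcases h' with h' | h'
    · have := g.inj (by omega) (by omega) h'; omega
    · exact hB _ h' h1T
  refine C.close g hz hz' hu hv' ?_ (h1A z (mem_sA.2 ⟨g.off_ne hz (by omega), hu⟩)) ?_ ?_ ?_ ?_
  · rintro rfl; exact hu' hu
  · intro h
    have h' := mem_nb.2 h.symm
    rw [e3, mem_insert] at h'
    rcases h' with h' | h'
    · have := g.inj (by omega) (by omega) h'; omega
    · exact hA _ h' h1T
  · intro h
    refine hA (p 2) (mem_sA.2 ⟨?_, h⟩) (g.mem (by omega))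
    intro h; have := g.inj (by omega) (by omega) h; omega
  · intro w hw w0 wv
    have h' := mem_nb.2 hw.symm
    rw [e3, mem_insert] at h'
    rcases h' with h' | h'
    · exact absurd h' wv
    · exact h1A w h'
  · have := hmin (p 1) h1T; omega

theorem Ctx.caseB (C : Ctx d T k m M) (g : Best d T k M G p) (hle : d (p 0) ≤ d (p (k - 1)))
    {z : V} (hz : z ∉ T) (hu : G.Adj (p 0) z) : False := by
  have hk := C.hk
  have hm := C.hm
  have h0 : p 0 ∈ T := g.mem (by omega)
  have hl : p (k - 1) ∈ T := g.mem (by omega)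
  have hne : p 0 ≠ p (k - 1) := fun h => by
    have := g.inj (by omega) (by omega) h; omega
  have t0 := C.top _ h0 z hz
  have hdd : d z = d (p (k - 1)) := by
    by_cases h : G.Adj (p (k - 1)) z
    · exact (C.two g.toGood hz h hu).2.1
    · exact (C.one' g.toGood hz h hu).1
  have hd3 : 3 ≤ d (p 0) := by
    by_contra hlt
    have h2 := C.H 2 (by omega) hm
    have hs : ({p 0, p (k - 1)} : Finset V) ⊆ T.filter (fun t => d t ≤ 2) := by
      intro x hx
      rw [mem_insert, mem_singleton] at hx
      rw [mem_filter]
      rcases hx with rfl | rfl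
      · exact ⟨h0, by omega⟩
      · exact ⟨hl, by omega⟩
    have := card_le_card hs
    rw [card_pair hne] at this
    omega
  by_cases hv : ∀ y, G.Adj (p (k - 1)) y → y ∈ T
  · refine C.caseA (C.bfull g) ?_ ?_
    · rw [rv_full_0, rv_full_last]; omega
    · rwa [rv_full_0]
  · push Not at hv
    obtain ⟨z', hv', hz'⟩ := hv
    by_cases hc : ∃ y, y ∉ T ∧ G.Adj (p 0) y ∧ G.Adj (p (k - 1)) y
    · obtain ⟨y, y1, y2, y3⟩ := hc
      exact C.caseB1 g.toGood y1 y3 y2 hd3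
    · push Not at hc
      exact C.caseB2 g.toGood hz hz' hu hv' hc hd3

theorem Ctx.contra (C : Ctx d T k m M) (g : Best d T k M G p) : False := by
  have main : ∀ {G : SimpleGraph V} {p : ℕ → V}, Best d T k M G p → d (p 0) ≤ d (p (k - 1)) → False := by
    intro G p g h
    by_cases hu : ∀ z, G.Adj (p 0) z → z ∈ T
    · exact C.caseA g h hu
    · push Not at hu
      obtain ⟨z, hz, hz'⟩ := hu
      exact C.caseB g h hz' hz
  rcases le_total (d (p 0)) (d (p (k - 1))) with h | h
  · exact main g h
  · refine main (C.bfull g) ?_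
    rwa [rv_full_0, rv_full_last]

theorem exists_max_of {α : Type*} (P : α → Prop) (f : α → ℕ) (B : ℕ) (hB : ∀ a, P a → f a ≤ B)
    (h : ∃ a, P a) : ∃ a, P a ∧ ∀ b, P b → f b ≤ f a := by
  obtain ⟨a, ha⟩ := h
  have := Nat.findGreatest_spec (P := fun t => ∃ a, P a ∧ f a = t) (hB a ha) ⟨a, ha, rfl⟩
  obtain ⟨b, hb, e⟩ := this
  refine ⟨b, hb, fun c hc => ?_⟩
  rw [e]
  exact Nat.le_findGreatest (hB c hc) ⟨c, hc, rfl⟩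

theorem upper_core (d : V → ℕ) (T : Finset V) (m : ℕ) (hm : 2 ≤ m) (hT : T.card = 2 * m + 2)
    (hG : ∃ G, Rlz G d) (top : ∀ t ∈ T, ∀ z, z ∉ T → d z ≤ d t)
    (H : ∀ i, 1 ≤ i → i ≤ m → (T.filter (fun t => d t ≤ i)).card < i) :
    ∃ (G : SimpleGraph V), Rlz G d ∧
      ∃ (v : V) (c : G.Walk v v), c.IsCycle ∧ c.length = 2 * m + 2 := by
  by_contra hno
  obtain ⟨G0, hG0⟩ := hG
  obtain ⟨p0, hp0⟩ : ∃ p : ℕ → V, Lay (2 * m + 2) T p := by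
    have e := (Finset.equivFinOfCardEq hT).symm
    have t0 := e ⟨0, by omega⟩
    refine ⟨fun i => if h : i < 2 * m + 2 then (e ⟨i, h⟩ : V) else t0, ?_, ?_⟩
    · intro i hi j hj h
      simp only [hi, hj, dif_pos] at h
      have := e.injective (Subtype.ext h)
      simpa using this
    · intro v
      constructor
      · intro hv
        refine ⟨e.symm ⟨v, hv⟩, (e.symm ⟨v, hv⟩).2, ?_⟩
        simp
      · rintro ⟨i, hi, rfl⟩
        simp only [hi, dif_pos]
        exact (e ⟨i, hi⟩).2
  obtain ⟨x, ⟨hx1, hx2⟩, hx⟩ := exists_max_of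
    (fun x : SimpleGraph V × (ℕ → V) => Rlz x.1 d ∧ Lay (2 * m + 2) T x.2)
    (fun x => cnt x.1 (2 * m + 2) x.2) (2 * m + 2 - 1) (fun a _ => cnt_le _ _ _) ⟨(G0, p0), hG0, hp0⟩
  have C : Ctx d T (2 * m + 2) m (cnt x.1 (2 * m + 2) x.2) :=
    { hk := rfl
      hm := hm
      top := top
      H := H
      max := fun G p h1 h2 => hx (G, p) ⟨h1, h2⟩
      nadj := by
        intro G p h1 h2 h3 h4
        apply hno
        refine ⟨G, h1, cycle_of_seq (by omega) h2.1 ?_ h4⟩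
        exact fin_adj h2 (fun q hq => hx (G, q) ⟨h1, hq⟩) h3 h4 }
  obtain ⟨y, hy, hy'⟩ := exists_max_of
    (fun y : SimpleGraph V × (ℕ → V) => Good d T (2 * m + 2) (cnt x.1 (2 * m + 2) x.2) y.1 y.2)
    (fun y => d (y.2 0) + d (y.2 (2 * m + 2 - 1))) (∑ v, d v + ∑ v, d v)
    (fun a _ => Nat.add_le_add (single_le_sum (fun _ _ => Nat.zero_le _) (mem_univ _))
      (single_le_sum (fun _ _ => Nat.zero_le _) (mem_univ _))) ⟨x, hx1, hx2, rfl⟩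
  exact C.contra ⟨hy, fun G' p' g' => hy' (G', p') g'⟩
end Core2

section Arith
open Classical

variable {V : Type*} [Fintype V]

theorem card_nb_sum [DecidableEq V] (G : SimpleGraph V) (v : V) (s : Finset V) :
    ((nb G v) ∩ s).card = ∑ w ∈ s, ind (G.Adj v w) := by
  unfold ind
  rw [← card_filter]
  congr 1
  ext w
  simp [mem_nb, and_comm]

theorem sum_swap [DecidableEq V] (G : SimpleGraph V) (s t : Finset V) :
    ∑ v ∈ s, (nb G v ∩ t).card = ∑ v ∈ t, (nb G v ∩ s).card := by
  simp only [card_nb_sum]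
  rw [sum_comm]
  simp only [G.adj_comm]

theorem nb_split [DecidableEq V] (G : SimpleGraph V) (v : V) (s : Finset V) :
    (nb G v).card = (nb G v ∩ s).card + (nb G v ∩ sᶜ).card := by
  rw [← card_union_of_disjoint, ← inter_union_distrib_left, union_compl, inter_univ]
  exact (disjoint_compl_right (a := s)).mono inter_subset_right inter_subset_right

theorem sum_bound {G : SimpleGraph V} {d : V → ℕ} (hG : Rlz G d) (L : Finset V) :
    ∑ v, d v ≤ L.card * (L.card - 1) + 2 * ∑ v ∈ Lᶜ, d v := by
  rw [← sum_add_sum_compl L]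
  have h1 : ∑ v ∈ L, d v = ∑ v ∈ L, (nb G v ∩ L).card + ∑ v ∈ L, (nb G v ∩ Lᶜ).card := by
    rw [← sum_add_distrib]
    exact sum_congr rfl (fun v _ => by rw [← hG v, ← nb_split])
  have h2 : ∑ v ∈ L, (nb G v ∩ L).card ≤ L.card * (L.card - 1) := by
    rw [← smul_eq_mul]
    apply sum_le_card_nsmul
    intro v hv
    rw [← card_erase_of_mem hv]
    apply card_le_card
    intro w hw
    rw [mem_inter, mem_nb] at hw
    exact mem_erase.2 ⟨hw.1.ne', hw.2⟩
  have h3 : ∑ v ∈ L, (nb G v ∩ Lᶜ).card ≤ ∑ v ∈ Lᶜ, d v := by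
    rw [sum_swap]
    exact sum_le_sum (fun v _ => by rw [← hG v]; exact card_le_card inter_subset_left)
  omega

theorem sum_bound2 {G : SimpleGraph V} {d : V → ℕ} (hG : Rlz G d) (L : Finset V) (i : ℕ)
    (h : ∀ v, v ∉ L → d v ≤ i) :
    ∑ v, d v ≤ L.card * (L.card - 1) + 2 * ((Fintype.card V - L.card) * i) := by
  have h1 := sum_bound hG L
  have h2 := sum_le_card_nsmul Lᶜ d i (fun x hx => h x (mem_compl.1 hx))
  rw [smul_eq_mul, card_compl] at h2
  exact le_trans h1 (Nat.add_le_add_left (Nat.mul_le_mul_left 2 h2) _)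

theorem card_lt_fin {n a : ℕ} (h : a ≤ n) : (univ.filter (fun i : Fin n => (i : ℕ) < a)).card = a := by
  rw [Fin.card_filter_val_lt]; exact min_eq_right h

theorem arith_bound {m i r : ℕ} (h1 : 1 ≤ i) (h2 : i ≤ m) :
    (2 * m + 2 - i) * (2 * m + 2 - i - 1) + 2 * (i * (r + i)) ≤
     max (2 * (2 * m + 2 + r) + 4 * m ^ 2 - 2 * m - 2) (m * (2 * (2 * m + 2 + r) - m - 1) + 2) := by
  have a1 : 2 * (2 * m + 2 + r) + 4 * m ^ 2 - 2 * m - 2 = 4 * m ^ 2 + 2 * m + 2 + 2 * r := by omega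
  have a2 : 2 * (2 * m + 2 + r) - m - 1 = 3 * m + 3 + 2 * r := by omega
  rw [a1, a2]
  obtain ⟨s, hs⟩ : ∃ s, 2 * m + 2 = i + s + 1 := ⟨2 * m + 1 - i, by omega⟩
  have a3 : 2 * m + 2 - i = s + 1 := by omega
  rw [a3, Nat.add_sub_cancel, le_max_iff]
  by_contra hc
  push Not at hc
  obtain ⟨c1, c2⟩ := hc
  have hs' : (s : ℤ) = 2 * m + 1 - i := by omega
  zify at c1 c2 h1 h2
  rw [hs'] at c1 c2
  have e1 : ((i : ℤ) - 1) * (3 * (i + 1) + (2 * r - 4 * m - 3)) > 0 := by nlinarith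
  have e2 : ((m : ℤ) - i) * (3 * (i + m) + (2 * r - 4 * m - 3)) < 0 := by nlinarith
  have e3 : (3 * ((i : ℤ) + 1) + (2 * r - 4 * m - 3)) > 0 := by
    by_contra h
    nlinarith
  nlinarith

theorem H_of_sum {m n : ℕ} (hn : 2 * m + 2 ≤ n) {d : Fin n → ℕ} (hd : Antitone d)
    (hG : ∃ G, Rlz G d)
    (hs : max (2 * n + 4 * m ^ 2 - 2 * m - 2) (m * (2 * n - m - 1) + 2) + 2 ≤ ∑ i, d i)
    (i : ℕ) (h1 : 1 ≤ i) (h2 : i ≤ m) :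
    ((univ.filter (fun t : Fin n => (t : ℕ) < 2 * m + 2)).filter (fun t => d t ≤ i)).card < i := by
  by_contra hc
  push Not at hc
  obtain ⟨G, hG⟩ := hG
  obtain ⟨t, ht1, ht2⟩ : ∃ t : Fin n, (t : ℕ) ≤ 2 * m + 2 - i ∧ d t ≤ i := by
    by_contra hno
    push Not at hno
    have : ((univ.filter (fun t : Fin n => (t : ℕ) < 2 * m + 2)).filter (fun t => d t ≤ i)).card ≤
        (Ioo (2 * m + 2 - i) (2 * m + 2)).card := by
      apply card_le_card_of_injOn (fun t : Fin n => (t : ℕ))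
      · intro t ht
        rw [mem_coe, mem_filter, mem_filter] at ht
        rw [mem_coe, mem_Ioo]
        refine ⟨?_, ht.1.2⟩
        dsimp only
        by_contra hlt
        have := hno t (by omega)
        omega
      · intro a _ b _ e; exact Fin.ext e
    rw [Nat.card_Ioo] at this
    omega
  have hb := sum_bound2 hG (univ.filter (fun j : Fin n => (j : ℕ) < 2 * m + 2 - i)) i (by
      intro x hx
      rw [mem_filter] at hx
      have hx' : 2 * m + 2 - i ≤ (x : ℕ) := by
        by_contra h; exact hx ⟨mem_univ _, by omega⟩
      exact le_trans (hd (show t ≤ x from Fin.le_def.2 (by omega))) ht2)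
  rw [card_lt_fin (by omega), Fintype.card_fin] at hb
  obtain ⟨r, rfl⟩ : ∃ r, n = 2 * m + 2 + r := ⟨n - (2 * m + 2), by omega⟩
  have hA := arith_bound (r := r) h1 h2
  have e : 2 * m + 2 + r - (2 * m + 2 - i) = r + i := by omega
  rw [e, mul_comm (r + i) i] at hb
  omega

/-- vertex set and cycle graph of a cycle -/
theorem cyc_set {G : SimpleGraph V} {v : V} {c : G.Walk v v} (hc : c.IsCycle) :
    ∃ (C : SimpleGraph V) (S : Finset V), C ≤ G ∧ S.card = c.length ∧ (∀ x ∈ S, (nb C x).card = 2) ∧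
      ∀ x, x ∉ S → (nb C x).card = 0 := by
  refine ⟨c.toSubgraph.spanningCoe, c.support.tail.toFinset, c.toSubgraph.spanningCoe_le, ?_, ?_, ?_⟩
  · rw [List.toFinset_card_of_nodup hc.support_nodup, List.length_tail, c.length_support]
    rfl
  · intro x hx
    have hx' : x ∈ c.support := List.mem_of_mem_tail (List.mem_toFinset.1 hx)
    rw [← hc.ncard_neighborSet_toSubgraph_eq_two hx', ← Set.ncard_coe_finset]
    congr 1
    ext w
    simp [mem_nb]
  · intro x hx
    rw [card_eq_zero, eq_empty_iff_forall_notMem]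
    intro w hw
    rw [mem_nb, SimpleGraph.Subgraph.spanningCoe_adj] at hw
    have h1 := hw.fst_mem
    rw [SimpleGraph.Walk.mem_verts_toSubgraph] at h1
    apply hx
    rw [List.mem_toFinset]
    rw [SimpleGraph.Walk.mem_support_iff] at h1
    rcases h1 with rfl | h1
    · exact SimpleGraph.Walk.end_mem_tail_support hc.not_nil
    · exact h1
end Arith

section Lower
open Classical

theorem lower1 (m n : ℕ) (hm : 2 ≤ m) (hn : 2 * m + 2 ≤ n) :
    ∃ d : Fin n → ℕ, Antitone d ∧ (∃ G, Rlz G d) ∧ ∑ i, d i = 2 * n + 4 * m ^ 2 - 2 * m - 2 ∧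
     ∀ G, Rlz G d → ∀ (v : Fin n) (c : G.Walk v v), c.IsCycle → c.length ≠ 2 * m + 2 := by
  refine ⟨fun i => if (i : ℕ) = 0 then n - 1 else if (i : ℕ) ≤ 2 * m then 2 * m else 1, ?_, ?_, ?_, ?_⟩
  · intro i j h
    have h' := Fin.le_def.1 h
    dsimp only
    split_ifs <;> omega
  · refine ⟨⟨fun i j => i ≠ j ∧ ((i : ℕ) = 0 ∨ (j : ℕ) = 0 ∨ ((i : ℕ) ≤ 2 * m ∧ (j : ℕ) ≤ 2 * m)),
      ⟨fun i j h => ⟨h.1.symm, by tauto⟩⟩, ⟨fun i h => h.1 rfl⟩⟩, ?_⟩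
    intro v
    dsimp only
    split_ifs with h1 h2
    · trans (univ.erase v).card
      · congr 1; ext w
        rw [mem_nb, mem_erase]
        constructor
        · intro h; exact ⟨h.1.symm, mem_univ _⟩
        · intro h; exact ⟨h.1.symm, Or.inl h1⟩
      · rw [card_erase_of_mem (mem_univ _), card_univ, Fintype.card_fin]
    · trans ((univ.filter (fun w : Fin n => (w : ℕ) < 2 * m + 1)).erase v).card
      · congr 1; ext w
        rw [mem_nb, mem_erase, mem_filter]
        constructor
        · intro h; exact ⟨h.1.symm, mem_univ _, by rcases h.2 with h | h | h <;> omega⟩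
        · intro h; exact ⟨h.1.symm, Or.inr (Or.inr ⟨h2, by omega⟩)⟩
      · rw [card_erase_of_mem (mem_filter.2 ⟨mem_univ _, by omega⟩), card_lt_fin (by omega)]; rfl
    · rw [card_eq_one]
      refine ⟨⟨0, by omega⟩, ?_⟩
      ext w
      rw [mem_nb, mem_singleton]
      constructor
      · intro h; apply Fin.ext; rcases h.2 with h | h | h
        · omega
        · exact h
        · omega
      · rintro rfl
        exact ⟨fun h => h1 (by rw [h]), Or.inr (Or.inl rfl)⟩
  · rw [Fin.sum_univ_eq_sum_range (fun i => if i = 0 then n - 1 else if i ≤ 2 * m then 2 * m else 1)]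
    obtain ⟨r, rfl⟩ : ∃ r, n = 2 * m + 1 + r := ⟨n - (2 * m + 1), by omega⟩
    rw [sum_range_add, sum_range_succ']
    rw [sum_congr (s₂ := range (2 * m)) rfl (g := fun _ => 2 * m) (by
      intro x hx; rw [mem_range] at hx
      rw [if_neg (by omega), if_pos (by omega)])]
    rw [sum_congr (s₂ := range r) rfl (g := fun _ => 1) (by
      intro x hx; rw [mem_range] at hx
      rw [if_neg (by omega), if_neg (by omega)])]
    simp only [sum_const, card_range, smul_eq_mul, if_true]
    have : 2 * m * (2 * m) = 4 * m ^ 2 := by ring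
    rw [this]; omega
  · intro G hG v c hc hl
    obtain ⟨C, S, hCG, hS, h2, -⟩ := cyc_set hc
    have : S ⊆ univ.filter (fun w : Fin n => (w : ℕ) < 2 * m + 1) := by
      intro x hx
      rw [mem_filter]
      refine ⟨mem_univ _, ?_⟩
      by_contra hlt
      have h3 := hG x
      have h4 : (nb C x).card ≤ (nb G x).card :=
        card_le_card (fun y hy => mem_nb.2 (hCG (mem_nb.1 hy)))
      rw [h2 x hx] at h4
      dsimp only at h3
      rw [if_neg (by omega), if_neg (by omega)] at h3
      omega
    have := card_le_card this
    rw [card_lt_fin (by omega)] at this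
    omega

theorem lower2 (m n : ℕ) (hm : 2 ≤ m) (hn : 2 * m + 2 ≤ n) :
    ∃ d : Fin n → ℕ, Antitone d ∧ (∃ G, Rlz G d) ∧ ∑ i, d i = m * (2 * n - m - 1) + 2 ∧
     ∀ G, Rlz G d → ∀ (v : Fin n) (c : G.Walk v v), c.IsCycle → c.length ≠ 2 * m + 2 := by
  refine ⟨fun i => if (i : ℕ) < m then n - 1 else if (i : ℕ) < m + 2 then m + 1 else m, ?_, ?_, ?_, ?_⟩
  · intro i j h
    have h' := Fin.le_def.1 h
    dsimp only
    split_ifs <;> omega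
  · refine ⟨⟨fun i j => i ≠ j ∧ ((i : ℕ) < m ∨ (j : ℕ) < m ∨ ((i : ℕ) < m + 2 ∧ (j : ℕ) < m + 2)),
      ⟨fun i j h => ⟨h.1.symm, by tauto⟩⟩, ⟨fun i h => h.1 rfl⟩⟩, ?_⟩
    intro v
    dsimp only
    split_ifs with h1 h2
    · trans (univ.erase v).card
      · congr 1; ext w
        rw [mem_nb, mem_erase]
        constructor
        · intro h; exact ⟨h.1.symm, mem_univ _⟩
        · intro h; exact ⟨h.1.symm, Or.inl h1⟩
      · rw [card_erase_of_mem (mem_univ _), card_univ, Fintype.card_fin]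
    · trans ((univ.filter (fun w : Fin n => (w : ℕ) < m + 2)).erase v).card
      · congr 1; ext w
        rw [mem_nb, mem_erase, mem_filter]
        constructor
        · intro h; exact ⟨h.1.symm, mem_univ _, by rcases h.2 with h | h | h <;> omega⟩
        · intro h; exact ⟨h.1.symm, Or.inr (Or.inr ⟨h2, h.2.2⟩)⟩
      · rw [card_erase_of_mem (mem_filter.2 ⟨mem_univ _, by omega⟩), card_lt_fin (by omega)]; rfl
    · trans (univ.filter (fun w : Fin n => (w : ℕ) < m)).card
      · congr 1; ext w
        rw [mem_nb, mem_filter]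
        constructor
        · intro h; exact ⟨mem_univ _, by rcases h.2 with h | h | h <;> omega⟩
        · intro h; exact ⟨fun e => h1 (by rw [e]; exact h.2), Or.inr (Or.inl h.2)⟩
      · rw [card_lt_fin (by omega)]
  · rw [Fin.sum_univ_eq_sum_range (fun i => if i < m then n - 1 else if i < m + 2 then m + 1 else m)]
    obtain ⟨r, rfl⟩ : ∃ r, n = m + 2 + r := ⟨n - (m + 2), by omega⟩
    rw [sum_range_add, sum_range_add]
    rw [sum_congr (s₂ := range m) rfl (g := fun _ => m + 1 + r) (by
      intro x hx; rw [mem_range] at hx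
      rw [if_pos (by omega)]; omega)]
    rw [sum_congr (s₂ := range 2) rfl (g := fun _ => m + 1) (by
      intro x hx; rw [mem_range] at hx
      rw [if_neg (by omega), if_pos (by omega)])]
    rw [sum_congr (s₂ := range r) rfl (g := fun _ => m) (by
      intro x hx; rw [mem_range] at hx
      rw [if_neg (by omega), if_neg (by omega)])]
    simp only [sum_const, card_range, smul_eq_mul]
    have : 2 * (m + 2 + r) - m - 1 = m + 3 + 2 * r := by omega
    rw [this]; ring
  · intro G hG v c hc hl
    obtain ⟨C, S, hCG, hS, h2, h0⟩ := cyc_set hc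
    set D := univ.filter (fun w : Fin n => (w : ℕ) < m) with hD
    have cD : D.card = m := card_lt_fin (by omega)
    have hdom : ∀ x ∈ D, ∀ y, y ≠ x → G.Adj x y := by
      intro x hx y hy
      have h3 := hG x
      dsimp only at h3
      rw [if_pos (mem_filter.1 hx).2] at h3
      have hsub : nb G x ⊆ univ.erase x := fun w hw => mem_erase.2 ⟨(mem_nb.1 hw).ne', mem_univ _⟩
      have := eq_of_subset_of_card_le hsub (by
        rw [card_erase_of_mem (mem_univ _), card_univ, Fintype.card_fin, h3])
      rw [← mem_nb, this]
      exact mem_erase.2 ⟨hy, mem_univ _⟩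
    have b1 : ∑ x ∈ S \ D, (nb C x ∩ D).card ≤ 2 * m := by
      rw [sum_swap]
      calc _ ≤ ∑ x ∈ D, 2 := sum_le_sum (fun x _ => by
              refine le_trans (card_le_card inter_subset_left) ?_
              by_cases hx : x ∈ S
              · rw [h2 x hx]
              · rw [h0 x hx]; omega)
        _ = 2 * m := by rw [sum_const, cD, smul_eq_mul, mul_comm]
    have b2 : ∑ x ∈ S \ D, (nb C x ∩ Dᶜ).card ≤ 2 := by
      calc _ ≤ ∑ x ∈ S \ D, (if (x : ℕ) < m + 2 then 1 else 0) := sum_le_sum (fun x hx => by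
              rw [mem_sdiff] at hx
              have hx' : ¬ (x : ℕ) < m := fun h => hx.2 (mem_filter.2 ⟨mem_univ _, h⟩)
              have h3 := hG x
              dsimp only at h3
              rw [if_neg hx'] at h3
              have h4 : (nb C x ∩ Dᶜ).card ≤ (nb G x ∩ Dᶜ).card :=
                card_le_card (fun y hy => by
                  rw [mem_inter] at hy ⊢
                  exact ⟨mem_nb.2 (hCG (mem_nb.1 hy.1)), hy.2⟩)
              have h5 := nb_split G x D
              have h6 : nb G x ∩ D = D := by
                apply inter_eq_right.2
                intro y hy
                exact mem_nb.2 (hdom y hy x (by rintro rfl; exact hx.2 hy)).symm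
              rw [h6, cD] at h5
              split_ifs at h3 ⊢ <;> omega)
        _ ≤ 2 := by
              rw [← card_filter]
              have hs : (S \ D).filter (fun x : Fin n => (x : ℕ) < m + 2) ⊆
                  (univ.filter (fun w : Fin n => (w : ℕ) < m + 2)) \ D := by
                intro x hx
                rw [mem_filter, mem_sdiff] at hx
                rw [mem_sdiff, mem_filter]
                exact ⟨⟨mem_univ _, hx.2⟩, hx.1.2⟩
              have := card_le_card hs
              rw [card_sdiff_of_subset, card_lt_fin (by omega), cD] at this
              · omega
              · intro x hx
                rw [mem_filter] at hx ⊢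
                exact ⟨mem_univ _, by omega⟩
    have b3 : ∑ x ∈ S \ D, (nb C x).card = ∑ x ∈ S \ D, (nb C x ∩ D).card +
        ∑ x ∈ S \ D, (nb C x ∩ Dᶜ).card := by
      rw [← sum_add_distrib]
      exact sum_congr rfl (fun x _ => nb_split C x D)
    have b4 : ∑ x ∈ S \ D, (nb C x).card = (S \ D).card * 2 := by
      rw [sum_congr rfl (fun x hx => h2 x (mem_sdiff.1 hx).1), sum_const, smul_eq_mul]
    have b5 := le_card_sdiff D S
    omega

theorem rlz_iff {n : ℕ} (G : SimpleGraph (Fin n)) (d : Fin n → ℕ) : IsDegreeSeq G d ↔ Rlz G d := by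
  unfold IsDegreeSeq Rlz
  refine forall_congr' (fun i => ?_)
  have : (G.neighborSet i).ncard = (nb G i).card := by
    rw [← Set.ncard_coe_finset]
    congr 1
    ext w; simp [mem_nb]
  rw [this]
end Lower

end AllHelpers

/-- **Theorem 1.4, even case.** For `m ≥ 2` and `n ≥ 2m+2`,
`σ(C_{2m+2}, n) = max{2n + 4m² − 2m − 2, m(2n − m − 1) + 2} + 2`: every graphic sequence
of length `n` with sum at least this value is potentially `C_{2m+2}`-graphic, and some
graphic sequence of length `n` with sum `max{2n + 4m² − 2m − 2, m(2n − m − 1) + 2}` is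
not potentially `C_{2m+2}`-graphic. -/
theorem sigma_C_even (m n : ℕ) (hm : 2 ≤ m) (hn : 2 * m + 2 ≤ n) :
    (∀ d : Fin n → ℕ, Antitone d → Graphic d →
      max (2 * n + 4 * m ^ 2 - 2 * m - 2) (m * (2 * n - m - 1) + 2) + 2 ≤ ∑ i, d i →
      PotC (2 * m + 2) d) ∧
    (∃ d : Fin n → ℕ, Antitone d ∧ Graphic d ∧
      ∑ i, d i = max (2 * n + 4 * m ^ 2 - 2 * m - 2) (m * (2 * n - m - 1) + 2) ∧
      ¬ PotC (2 * m + 2) d) := by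
  classical
  constructor
  · intro d hd hG hs
    obtain ⟨G0, hG0⟩ := hG
    have hR : ∃ G, Rlz G d := ⟨G0, (rlz_iff _ _).1 hG0⟩
    obtain ⟨G, h1, v, c, h2, h3⟩ := upper_core d
      (Finset.univ.filter (fun t : Fin n => (t : ℕ) < 2 * m + 2)) m hm (card_lt_fin hn) hR
      (by
        intro t ht z hz
        apply hd
        rw [Finset.mem_filter] at ht hz
        refine Fin.le_def.2 ?_
        by_contra hlt
        exact hz ⟨Finset.mem_univ _, by omega⟩)
      (by
        intro i h1 h2
        exact H_of_sum hn hd hR hs i h1 h2)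
    exact ⟨G, (rlz_iff _ _).2 h1, v, c, h2, h3⟩
  · rcases le_total (2 * n + 4 * m ^ 2 - 2 * m - 2) (m * (2 * n - m - 1) + 2) with h | h
    · rw [max_eq_right h]
      obtain ⟨d, h1, ⟨G, h2⟩, h3, h4⟩ := lower2 m n hm hn
      refine ⟨d, h1, ⟨G, (rlz_iff _ _).2 h2⟩, h3, ?_⟩
      rintro ⟨G', h5, v, c, h6, h7⟩
      exact h4 G' ((rlz_iff _ _).1 h5) v c h6 h7
    · rw [max_eq_left h]
      obtain ⟨d, h1, ⟨G, h2⟩, h3, h4⟩ := lower1 m n hm hn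
      refine ⟨d, h1, ⟨G, (rlz_iff _ _).2 h2⟩, h3, ?_⟩
      rintro ⟨G', h5, v, c, h6, h7⟩
      exact h4 G' ((rlz_iff _ _).1 h5) v c h6 h7
end
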